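/- If X, Y ⊆ ℝ² are Borel sets with X nonempty and dim_H Y > 1, then sup over x ∈ X of dim_H π_x(Y \ {x}) is at least min{dim_H X + dim_H Y − 1, 1}. -/

import Mathlib

open Metric MeasureTheory Set
open scoped ENNReal NNReal RealInnerProductSpace

noncomputable section

abbrev E2 := EuclideanSpace ℝ (Fin 2)

/-- Radial projection `π_x(y) = (y-x)/|y-x|`. -/
def radProj {E : Type*} [NormedAddCommGroup E] [NormedSpace ℝ E] (x y : E) : E :=
  ‖y - x‖⁻¹ • (y - x)

/-- A subset of a real vector space is an affine line. -/
def IsAffineLine {E : Type*} [AddCommGroup E] [Module ℝ E] (ℓ : Set E) : Prop :=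
  ∃ a v : E, v ≠ 0 ∧ ℓ = {p | ∃ t : ℝ, p = a + t • v}

/-- The (topological) support of a measure. -/
def msupport {E : Type*} [PseudoMetricSpace E] [MeasurableSpace E] (μ : Measure E) : Set E :=
  {x | ∀ r : ℝ, 0 < r → 0 < μ (ball x r)}

/-- `(μ,ν)` has `(t,K,c)`-thin tubes. -/
def ThinTubesWith (μ ν : Measure E2) (t K c : ℝ) : Prop :=
  ∃ G : Set (E2 × E2), MeasurableSet G ∧ G ⊆ (msupport μ) ×ˢ (msupport ν) ∧
    ENNReal.ofReal c ≤ (μ.prod ν) G ∧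
    ∀ x ∈ msupport μ, ∀ r : ℝ, 0 < r → ∀ ℓ : Set E2, IsAffineLine ℓ →
      x ∈ cthickening r ℓ →
      ν (cthickening r ℓ ∩ {y | (x, y) ∈ G}) ≤ ENNReal.ofReal (K * r ^ t)

/-- `(μ,ν)` has `t`-thin tubes. -/
def ThinTubes (μ ν : Measure E2) (t : ℝ) : Prop :=
  ∃ K c : ℝ, 0 < K ∧ 0 < c ∧ ThinTubesWith μ ν t K c

/-- Total weight of a set of indices. -/
def indexWeight {ι : Type*} (w : ι → ℝ≥0∞) (C : Set ι) : ℝ≥0∞ := ∑' i, C.indicator w i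

/-- The content of a set with respect to a weighted family of sets. -/
def netContent {ι X : Type*} (Q : ι → Set X) (w : ι → ℝ≥0∞) (A : Set X) : ℝ≥0∞ :=
  ⨅ (C : Set ι) (_ : A ⊆ ⋃ i ∈ C, Q i), indexWeight w C

/-- The members of an index set that are not contained in a member of smaller level. -/
def topMembers {ι X : Type*} (Q : ι → Set X) (lvl : ι → ℕ) (C : Set ι) : Set ι :=
  {i ∈ C | ∀ j ∈ C, lvl j < lvl i → ¬ Q i ⊆ Q j}

section NetContent

variable {ι X : Type*} {Q : ι → Set X} {w : ι → ℝ≥0∞} {lvl : ι → ℕ}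

lemma netContent_le {A : Set X} {C : Set ι} (h : A ⊆ ⋃ i ∈ C, Q i) :
    netContent Q w A ≤ indexWeight w C := iInf₂_le C h

lemma netContent_mono {A B : Set X} (h : A ⊆ B) : netContent Q w A ≤ netContent Q w B :=
  le_iInf₂ fun _ hC => netContent_le (h.trans hC)

lemma exists_indexWeight_le {A : Set X} (hA : netContent Q w A ≠ ∞) {ε : ℝ≥0∞} (hε : ε ≠ 0) :
    ∃ C : Set ι, A ⊆ ⋃ i ∈ C, Q i ∧ indexWeight w C ≤ netContent Q w A + ε := by
  have h := ENNReal.lt_add_right hA hε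
  conv_lhs at h => unfold netContent
  simp only [iInf_lt_iff] at h
  obtain ⟨C, hC, h⟩ := h
  exact ⟨C, hC, h.le⟩

lemma netContent_iUnion_le_tsum {κ : Type*} [Countable κ] (A : κ → Set X) :
    netContent Q w (⋃ k, A k) ≤ ∑' k, netContent Q w (A k) := by
  refine ENNReal.le_of_forall_pos_le_add fun ε hε hfin => ?_
  obtain ⟨ε', hε', hsum⟩ := ENNReal.exists_pos_sum_of_countable'
    (ENNReal.coe_pos.2 hε).ne' κ
  have hk : ∀ k, netContent Q w (A k) ≠ ∞ := fun k =>
    ((ENNReal.le_tsum k).trans_lt hfin).ne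
  choose C hC hCw using fun k => exists_indexWeight_le (hk k) (hε' k).ne'
  calc netContent Q w (⋃ k, A k) ≤ indexWeight w (⋃ k, C k) := by
        refine netContent_le (iUnion_subset fun k => (hC k).trans ?_)
        exact biUnion_subset_biUnion_left (subset_iUnion C k)
    _ ≤ ∑' k, indexWeight w (C k) := by
        unfold indexWeight
        rw [ENNReal.tsum_comm]
        refine ENNReal.tsum_le_tsum fun i => ?_
        by_cases hi : i ∈ ⋃ k, C k
        · obtain ⟨k, hk⟩ := mem_iUnion.1 hi
          rw [indicator_of_mem hi]
          calc w i = (C k).indicator w i := (indicator_of_mem hk _).symm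
            _ ≤ _ := ENNReal.le_tsum (f := fun k => (C k).indicator w i) k
        · simp [indicator_of_notMem hi]
    _ ≤ ∑' k, (netContent Q w (A k) + ε' k) := ENNReal.tsum_le_tsum hCw
    _ = ∑' k, netContent Q w (A k) + ∑' k, ε' k := ENNReal.tsum_add
    _ ≤ _ := by gcongr

lemma exists_topMembers (C : Set ι) : ∀ (n : ℕ) (i : ι), lvl i ≤ n → i ∈ C →
    ∃ j ∈ topMembers Q lvl C, Q i ⊆ Q j := by
  intro n
  induction n with
  | zero =>
    intro i hi hC
    exact ⟨i, ⟨hC, fun j _ h => by omega⟩, Subset.rfl⟩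
  | succ n ih =>
    intro i hi hC
    by_cases h : ∃ j ∈ C, lvl j < lvl i ∧ Q i ⊆ Q j
    · obtain ⟨j, hj, hlt, hsub⟩ := h
      obtain ⟨k, hk, hk'⟩ := ih j (by omega) hj
      exact ⟨k, hk, hsub.trans hk'⟩
    · push Not at h
      exact ⟨i, ⟨hC, h⟩, Subset.rfl⟩

lemma subset_iUnion_topMembers {A : Set X} {C : Set ι} (h : A ⊆ ⋃ i ∈ C, Q i) :
    A ⊆ ⋃ i ∈ topMembers Q lvl C, Q i := by
  intro x hx
  obtain ⟨i, hi, hxi⟩ := mem_iUnion₂.1 (h hx)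
  obtain ⟨j, hj, hij⟩ := exists_topMembers (Q := Q) C (lvl i) i le_rfl hi
  exact mem_iUnion₂.2 ⟨j, hj, hij hxi⟩

lemma indexWeight_topMembers_union_add_le
    (hQ : ∀ i j x, x ∈ Q i → x ∈ Q j →
      i = j ∨ (lvl i < lvl j ∧ Q j ⊆ Q i) ∨ (lvl j < lvl i ∧ Q i ⊆ Q j))
    {A : Set X} {C D : Set ι} (hC : A ⊆ ⋃ i ∈ C, Q i) (hD : A ⊆ ⋃ i ∈ D, Q i) :
    indexWeight w (topMembers Q lvl (D ∪ C)) + netContent Q w A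
      ≤ indexWeight w D + indexWeight w C := by
  set T := topMembers Q lvl (D ∪ C) with hT
  set E : Set ι := ((D ∪ C) \ T) ∪ (D ∩ C) with hE
  have hcov : A ⊆ ⋃ i ∈ E, Q i := by
    intro x hx
    obtain ⟨i, hi, hxi⟩ := mem_iUnion₂.1 (hC hx)
    obtain ⟨j, hj, hxj⟩ := mem_iUnion₂.1 (hD hx)
    rcases hQ i j x hxi hxj with rfl | ⟨h1, h2⟩ | ⟨h1, h2⟩
    · exact mem_iUnion₂.2 ⟨i, Or.inr ⟨hj, hi⟩, hxi⟩
    · exact mem_iUnion₂.2 ⟨j, Or.inl ⟨Or.inl hj, fun h => h.2 i (Or.inr hi) h1 h2⟩, hxj⟩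
    · exact mem_iUnion₂.2 ⟨i, Or.inl ⟨Or.inr hi, fun h => h.2 j (Or.inl hj) h1 h2⟩, hxi⟩
  calc indexWeight w T + netContent Q w A ≤ indexWeight w T + indexWeight w E := by
        gcongr; exact netContent_le hcov
    _ = ∑' i, (T.indicator w i + E.indicator w i) := ENNReal.tsum_add.symm
    _ ≤ ∑' i, (D.indicator w i + C.indicator w i) := by
        refine ENNReal.tsum_le_tsum fun i => ?_
        have hTs : i ∈ T → i ∈ D ∪ C := fun h => h.1
        by_cases h1 : i ∈ T <;> by_cases h2 : i ∈ D <;> by_cases h3 : i ∈ C <;>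
          simp_all [indicator]
    _ = _ := ENNReal.tsum_add

/-- Continuity from below of the content of a nested family. -/
lemma netContent_iUnion_le
    (hQ : ∀ i j x, x ∈ Q i → x ∈ Q j →
      i = j ∨ (lvl i < lvl j ∧ Q j ⊆ Q i) ∨ (lvl j < lvl i ∧ Q i ⊆ Q j))
    {A : ℕ → Set X} (hA : Monotone A) {c : ℝ≥0∞} (hc : ∀ n, netContent Q w (A n) ≤ c) :
    netContent Q w (⋃ n, A n) ≤ c := by
  refine ENNReal.le_of_forall_pos_le_add fun ε hε hfin => ?_
  obtain ⟨ε', hε', hsum⟩ := ENNReal.exists_pos_sum_of_countable'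
    (ENNReal.coe_pos.2 hε).ne' ℕ
  have hfinA : ∀ n, netContent Q w (A n) ≠ ∞ := fun n => ((hc n).trans_lt hfin).ne
  choose C hC hCw using fun n => exists_indexWeight_le (hfinA n) (hε' n).ne'
  let D : ℕ → Set ι := fun n => Nat.rec (C 0) (fun n D => topMembers Q lvl (D ∪ C (n + 1))) n
  have hDs : ∀ n, D (n + 1) = topMembers Q lvl (D n ∪ C (n + 1)) := fun n => rfl
  have hDcov : ∀ n, A n ⊆ ⋃ i ∈ D n, Q i := by
    intro n
    cases n with
    | zero => exact hC 0
    | succ n =>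
      rw [hDs]
      refine subset_iUnion_topMembers ((hC (n + 1)).trans ?_)
      exact biUnion_subset_biUnion_left subset_union_right
  have hDw : ∀ n, indexWeight w (D n) ≤ netContent Q w (A n) + ∑ i ∈ Finset.range (n + 1), ε' i := by
    intro n
    induction n with
    | zero => simpa using (show indexWeight w (D 0) ≤ _ from hCw 0)
    | succ n ih =>
      have h1 := indexWeight_topMembers_union_add_le (w := w) hQ
        ((hA (Nat.le_succ n)).trans (hC (n + 1))) (hDcov n)
      rw [← hDs] at h1
      have h2 : indexWeight w (D (n + 1)) + netContent Q w (A n) ≤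
          (netContent Q w (A (n + 1)) + ∑ i ∈ Finset.range (n + 1 + 1), ε' i)
            + netContent Q w (A n) := by
        refine h1.trans ((add_le_add ih (hCw (n + 1))).trans (le_of_eq ?_))
        rw [Finset.sum_range_succ _ (n + 1)]
        ring
      exact (ENNReal.add_le_add_iff_right (hfinA n)).1 h2
  have hDsub : ∀ n, D n ⊆ ⋃ m, C m := by
    intro n
    induction n with
    | zero => exact subset_iUnion C 0
    | succ n ih =>
      rw [hDs]
      exact fun i hi => hi.1.elim (fun h => ih h) fun h => mem_iUnion.2 ⟨_, h⟩
  set T := topMembers Q lvl (⋃ m, C m) with hT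
  have hTD : ∀ i ∈ T, ∀ᶠ n in Filter.atTop, i ∈ D n := by
    intro i hi
    obtain ⟨m, hm⟩ := mem_iUnion.1 hi.1
    filter_upwards [Filter.eventually_ge_atTop m] with n hn
    have hmem : ∀ k, i ∈ D k ∪ C (k + 1) → i ∈ D (k + 1) := fun k hk =>
      ⟨hk, fun j hj => hi.2 j (hj.elim (fun h => hDsub k h) fun h => mem_iUnion.2 ⟨_, h⟩)⟩
    induction n, hn using Nat.le_induction with
    | base =>
      cases m with
      | zero => exact hm
      | succ m => exact hmem m (Or.inr hm)
    | succ n _ ih => exact hmem n (Or.inl ih)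
  calc netContent Q w (⋃ n, A n) ≤ indexWeight w T := by
        refine netContent_le (subset_iUnion_topMembers (iUnion_subset fun n => (hC n).trans ?_))
        exact biUnion_subset_biUnion_left (subset_iUnion C n)
    _ ≤ c + ∑' n, ε' n := by
        unfold indexWeight
        rw [ENNReal.tsum_eq_iSup_sum]
        refine iSup_le fun F => ?_
        have hev : ∀ᶠ n in Filter.atTop, ∀ i ∈ F, i ∈ T → i ∈ D n :=
          (Finset.eventually_all F).2 fun i _ => by
            by_cases hi : i ∈ T
            · filter_upwards [hTD i hi] with n hn _ using hn
            · exact Filter.Eventually.of_forall fun n h => absurd h hi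
        obtain ⟨n, hn⟩ := hev.exists
        calc ∑ i ∈ F, T.indicator w i ≤ ∑ i ∈ F, (D n).indicator w i := by
              refine Finset.sum_le_sum fun i hi => ?_
              by_cases h : i ∈ T
              · rw [indicator_of_mem h, indicator_of_mem (hn i hi h)]
              · simp [indicator_of_notMem h]
          _ ≤ indexWeight w (D n) := ENNReal.sum_le_tsum F
          _ ≤ netContent Q w (A n) + ∑ i ∈ Finset.range (n + 1), ε' i := hDw n
          _ ≤ c + ∑' n, ε' n := add_le_add (hc n) (ENNReal.sum_le_tsum _)
    _ ≤ c + ε := by gcongr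

end NetContent

/-- A set function continuous from below is inner regular on analytic sets with respect to
compact sets, measured by their open neighbourhoods. -/
lemma AnalyticSet.exists_isCompact_forall_isOpen_lt {X : Type*} [TopologicalSpace X]
    {M : Set X → ℝ≥0∞} (hmono : ∀ A B, A ⊆ B → M A ≤ M B)
    (hcont : ∀ (A : ℕ → Set X) (c : ℝ≥0∞), Monotone A → (∀ n, M (A n) ≤ c) → M (⋃ n, A n) ≤ c)
    {Y : Set X} (hY : AnalyticSet Y) {c : ℝ≥0∞} (hc : c < M Y) :
    ∃ K ⊆ Y, IsCompact K ∧ ∀ U, IsOpen U → K ⊆ U → c < M U := by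
  rw [AnalyticSet] at hY
  rcases hY with rfl | ⟨f, hf, rfl⟩
  · exact ⟨∅, Subset.rfl, isCompact_empty, fun U _ h => hc.trans_le (hmono _ _ h)⟩
  let S : (ℕ → ℕ) → ℕ → Set (ℕ → ℕ) := fun g k => {σ | ∀ i < k, σ i ≤ g i}
  have hstep : ∀ (g : ℕ → ℕ) (k : ℕ), c < M (f '' S g k) →
      ∃ n, c < M (f '' (S g k ∩ {σ | σ k ≤ n})) := by
    intro g k h
    by_contra! hcon
    have hmon : Monotone fun n => f '' (S g k ∩ {σ | σ k ≤ n}) := fun m n hmn =>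
      image_mono (inter_subset_inter_right _ fun σ (hσ : σ k ≤ m) => hσ.trans hmn)
    refine (lt_irrefl c) (h.trans_le ((hmono _ _ ?_).trans (hcont _ c hmon hcon)))
    rintro _ ⟨σ, hσ, rfl⟩
    exact mem_iUnion.2 ⟨σ k, σ, ⟨hσ, le_refl (σ k)⟩, rfl⟩
  choose! next hnext using hstep
  let G : ℕ → (ℕ → ℕ) := fun n => Nat.rec (fun _ => 0) (fun k g => Function.update g k (next g k)) n
  have hGs : ∀ k, G (k + 1) = Function.update (G k) k (next (G k) k) := fun k => rfl
  have hGlt : ∀ k, c < M (f '' S (G k) k) := by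
    intro k
    induction k with
    | zero => simpa [S] using hc
    | succ k ih =>
      refine (hnext _ _ ih).trans_le (hmono _ _ (image_mono ?_))
      rintro σ ⟨h1, h2⟩ i hi
      rw [hGs]
      rcases Nat.lt_succ_iff_lt_or_eq.1 hi with h | rfl
      · rw [Function.update_of_ne h.ne]; exact h1 i h
      · rw [Function.update_self]; exact h2
  let g : ℕ → ℕ := fun i => G (i + 1) i
  have hGg : ∀ k i, i < k → G k i = g i := by
    intro k i hik
    induction k, (Nat.succ_le_of_lt hik) using Nat.le_induction with
    | base => rfl
    | succ k hk ih =>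
      rw [hGs, Function.update_of_ne (by omega)]
      exact ih (by omega)
  have hSg : ∀ k, S (G k) k = S g k := by
    intro k
    ext σ
    exact forall₂_congr fun i hi => by rw [hGg k i hi]
  have hcomp : IsCompact (Set.pi univ fun i => Iic (g i)) :=
    isCompact_univ_pi fun i => (finite_Iic (g i)).isCompact
  refine ⟨f '' (Set.pi univ fun i => Iic (g i)), image_subset_range _ _, hcomp.image hf, ?_⟩
  intro U hU hKU
  suffices h : ∃ k, f '' S g k ⊆ U by
    obtain ⟨k, hk⟩ := h
    have := hGlt k
    rw [hSg] at this
    exact this.trans_le (hmono _ _ hk)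
  by_contra! hcon
  have hσ : ∀ k, ∃ σ ∈ S g k, f σ ∉ U := by
    intro k
    obtain ⟨y, ⟨σ, hσ, rfl⟩, hy⟩ := not_subset.1 (hcon k)
    exact ⟨σ, hσ, hy⟩
  choose σ hσS hσU using hσ
  let τ : ℕ → (ℕ → ℕ) := fun k i => min (σ k i) (g i)
  have hτ : ∀ k, τ k ∈ Set.pi univ fun i => Iic (g i) := fun k i _ =>
    mem_Iic.2 (min_le_right (σ k i) (g i))
  obtain ⟨a, ha, φ, hφ, hlim⟩ := hcomp.tendsto_subseq hτ
  have hlim' : Filter.Tendsto (σ ∘ φ) Filter.atTop (nhds a) := by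
    rw [tendsto_pi_nhds] at hlim ⊢
    intro i
    refine (hlim i).congr' ?_
    filter_upwards [hφ.tendsto_atTop.eventually_gt_atTop i] with n hn
    exact min_eq_left (hσS (φ n) i hn)
  have hfa : f a ∈ U := hKU ⟨a, ha, rfl⟩
  have := ((hf.tendsto a).comp hlim').eventually (hU.mem_nhds hfa)
  obtain ⟨n, hn⟩ := this.exists
  exact hσU _ hn

/-- Indices of dyadic squares: generation and integer corner. -/
abbrev DyadicIndex := ℕ × ℤ × ℤ

/-- Half-open dyadic squares in the plane. -/
def dyadicSquare (i : DyadicIndex) : Set (ℝ × ℝ) :=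
  {p | ⌊2 ^ i.1 * p.1⌋ = i.2.1 ∧ ⌊2 ^ i.1 * p.2⌋ = i.2.2}

/-- The weight of a dyadic square is the `t`-th power of its side. -/
def dyadicWeight (t : ℝ) (i : DyadicIndex) : ℝ≥0∞ := ENNReal.ofReal (((2 : ℝ) ^ i.1)⁻¹ ^ t)

lemma floor_two_pow_mul_eq_of_le {m n : ℕ} (h : m ≤ n) (x : ℝ) :
    ⌊(2 : ℝ) ^ m * x⌋ = ⌊(2 : ℝ) ^ n * x⌋ / 2 ^ (n - m) := by
  obtain ⟨k, rfl⟩ := Nat.exists_eq_add_of_le h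
  have : (2 : ℝ) ^ m * x = (2 ^ (m + k) * x) / ((2 ^ k : ℕ) : ℝ) := by
    push_cast
    rw [pow_add]; field_simp
  rw [this, Int.floor_div_natCast]
  simp

lemma dyadicSquare_nested (i j : DyadicIndex) (x : ℝ × ℝ) (hi : x ∈ dyadicSquare i)
    (hj : x ∈ dyadicSquare j) :
    i = j ∨ (i.1 < j.1 ∧ dyadicSquare j ⊆ dyadicSquare i) ∨
      (j.1 < i.1 ∧ dyadicSquare i ⊆ dyadicSquare j) := by
  have key : ∀ i j : DyadicIndex, i.1 < j.1 → x ∈ dyadicSquare i → x ∈ dyadicSquare j →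
      dyadicSquare j ⊆ dyadicSquare i := by
    intro i j hij hi hj y hy
    refine ⟨?_, ?_⟩
    · rw [floor_two_pow_mul_eq_of_le hij.le, hy.1, ← hj.1, ← floor_two_pow_mul_eq_of_le hij.le, hi.1]
    · rw [floor_two_pow_mul_eq_of_le hij.le, hy.2, ← hj.2, ← floor_two_pow_mul_eq_of_le hij.le, hi.2]
  rcases lt_trichotomy i.1 j.1 with h | h | h
  · exact Or.inr (Or.inl ⟨h, key i j h hi hj⟩)
  · refine Or.inl (Prod.ext h (Prod.ext ?_ ?_))
    · rw [← hi.1, ← hj.1, h]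
    · rw [← hi.2, ← hj.2, h]
  · exact Or.inr (Or.inr ⟨h, key j i h hj hi⟩)

/-- Sets with arbitrarily small covering sums are null for the Hausdorff measure. -/
lemma hausdorffMeasure_eq_zero_of_forall_cover {E : Type*} [EMetricSpace E] [MeasurableSpace E]
    [BorelSpace E] {t : ℝ} (ht : 0 < t) {A : Set E}
    (h : ∀ ε : ℝ≥0∞, ε ≠ 0 → ∃ (ι : Type) (_ : Countable ι) (Q : ι → Set E),
      A ⊆ ⋃ i, Q i ∧ ∑' i, ediam (Q i) ^ t ≤ ε) : μH[t] A = 0 := by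
  have h' : ∀ n : ℕ, ∃ (ι : Type) (_ : Countable ι) (Q : ι → Set E),
      A ⊆ ⋃ i, Q i ∧ ∑' i, ediam (Q i) ^ t ≤ (n : ℝ≥0∞)⁻¹ :=
    fun n => h _ (by simp)
  choose ι hι Q hQ hs using h'
  have hlim := ENNReal.tendsto_inv_nat_nhds_zero
  have hlim' : Filter.Tendsto (fun n : ℕ => ((n : ℝ≥0∞)⁻¹) ^ (1 / t)) Filter.atTop (nhds 0) := by
    have := hlim.ennrpow_const (1 / t)
    rwa [ENNReal.zero_rpow_of_pos (by positivity)] at this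
  have key := Measure.hausdorffMeasure_le_liminf_tsum t A _ hlim' Q
    (Filter.Eventually.of_forall fun n i => by
      have h1 : ediam (Q n i) ^ t ≤ (n : ℝ≥0∞)⁻¹ := (ENNReal.le_tsum i).trans (hs n)
      have h2 := ENNReal.rpow_le_rpow h1 (z := 1 / t) (by positivity)
      rwa [← ENNReal.rpow_mul, mul_one_div_cancel ht.ne', ENNReal.rpow_one] at h2)
    (Filter.Eventually.of_forall hQ)
  refine le_antisymm (key.trans ?_) bot_le
  exact (Filter.liminf_le_liminf (Filter.Eventually.of_forall hs)).trans hlim.liminf_eq.le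

lemma ediam_dyadicSquare_le (i : DyadicIndex) :
    ediam (dyadicSquare i) ≤ ENNReal.ofReal (((2 : ℝ) ^ i.1)⁻¹) := by
  have key : ∀ x y : ℝ, ⌊(2 : ℝ) ^ i.1 * x⌋ = ⌊(2 : ℝ) ^ i.1 * y⌋ → dist x y ≤ ((2 : ℝ) ^ i.1)⁻¹ := by
    intro x y h
    have h1 := (Int.abs_sub_lt_one_of_floor_eq_floor h).le
    rw [← mul_sub, abs_mul, abs_of_pos (by positivity : (0 : ℝ) < 2 ^ i.1)] at h1
    rw [Real.dist_eq, ← one_div, le_div_iff₀ (by positivity)]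
    linarith
  refine ediam_le fun p hp q hq => ?_
  rw [edist_dist]
  refine ENNReal.ofReal_le_ofReal ?_
  rw [Prod.dist_eq]
  exact max_le (key _ _ (hp.1.trans hq.1.symm)) (key _ _ (hp.2.trans hq.2.symm))

lemma netContent_dyadic_ne_zero {t : ℝ} (ht : 0 < t) {Y : Set (ℝ × ℝ)} (hY : μH[t] Y ≠ 0) :
    netContent dyadicSquare (dyadicWeight t) Y ≠ 0 := by
  intro h0
  refine hY (hausdorffMeasure_eq_zero_of_forall_cover ht fun ε hε => ?_)
  obtain ⟨C, hC, hw⟩ := exists_indexWeight_le (by rw [h0]; simp) hε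
  refine ⟨C, inferInstance, fun i => dyadicSquare i, ?_, ?_⟩
  · rwa [biUnion_eq_iUnion] at hC
  · rw [h0, zero_add] at hw
    refine le_trans ?_ hw
    unfold indexWeight
    rw [← tsum_subtype]
    refine ENNReal.tsum_le_tsum fun i => ?_
    have := ENNReal.rpow_le_rpow (ediam_dyadicSquare_le i) ht.le
    rwa [ENNReal.ofReal_rpow_of_pos (by positivity)] at this

lemma netContent_ball_le {t : ℝ} {p : ℝ × ℝ} {r : ℝ} {k : ℕ} (hr : 2 * r ≤ ((2 : ℝ) ^ k)⁻¹) :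
    netContent dyadicSquare (dyadicWeight t) (ball p r)
      ≤ 4 * ENNReal.ofReal (((2 : ℝ) ^ k)⁻¹ ^ t) := by
  have key : ∀ a x : ℝ, dist x a < r →
      ⌊(2 : ℝ) ^ k * x⌋ ∈ ({⌊(2 : ℝ) ^ k * (a - r)⌋, ⌊(2 : ℝ) ^ k * (a - r)⌋ + 1} : Finset ℤ) := by
    intro a x h
    have hx := abs_lt.1 (Real.dist_eq x a ▸ h)
    have hpos : (0 : ℝ) < 2 ^ k := by positivity
    have h1 : (2 : ℝ) ^ k * (a - r) ≤ 2 ^ k * x := by gcongr; linarith [hx.1]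
    have h2 : (2 : ℝ) ^ k * x ≤ 2 ^ k * (a - r) + 1 := by
      have : (2 : ℝ) ^ k * (2 * r) ≤ 1 := by
        have := mul_le_mul_of_nonneg_left hr hpos.le
        rwa [mul_inv_cancel₀ hpos.ne'] at this
      nlinarith [hx.2]
    have h3 := Int.floor_le_floor h1
    have h4 := Int.floor_le_floor h2
    rw [Int.floor_add_one] at h4
    simp only [Finset.mem_insert, Finset.mem_singleton]
    omega
  set S : Finset DyadicIndex := {k} ×ˢ
    ({⌊(2 : ℝ) ^ k * (p.1 - r)⌋, ⌊(2 : ℝ) ^ k * (p.1 - r)⌋ + 1} ×ˢ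
      {⌊(2 : ℝ) ^ k * (p.2 - r)⌋, ⌊(2 : ℝ) ^ k * (p.2 - r)⌋ + 1}) with hS
  refine (netContent_le (C := (S : Set DyadicIndex)) ?_).trans ?_
  · intro x hx
    have hx' := hx
    rw [mem_ball, Prod.dist_eq, max_lt_iff] at hx'
    refine mem_iUnion₂.2 ⟨(k, ⌊(2 : ℝ) ^ k * x.1⌋, ⌊(2 : ℝ) ^ k * x.2⌋), ?_, rfl, rfl⟩
    simp only [hS, Finset.mem_coe, Finset.mem_product]
    exact ⟨by simp, key _ _ hx'.1, key _ _ hx'.2⟩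
  · unfold indexWeight
    rw [← tsum_subtype, Finset.tsum_subtype']
    calc ∑ i ∈ S, dyadicWeight t i = ∑ i ∈ S, ENNReal.ofReal (((2 : ℝ) ^ k)⁻¹ ^ t) := by
          refine Finset.sum_congr rfl fun i hi => ?_
          simp only [hS, Finset.mem_product, Finset.mem_singleton] at hi
          rw [dyadicWeight, hi.1]
      _ = (S.card : ℝ≥0∞) * _ := by rw [Finset.sum_const, nsmul_eq_mul]
      _ ≤ _ := by
          gcongr
          have : S.card ≤ 4 := by
            rw [hS, Finset.card_product, Finset.card_product]
            simp
          exact_mod_cast this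

/-- Every finite cover by closed balls has `s`-dimensional sum at least `c`. -/
def BallContentGE {E : Type*} [PseudoMetricSpace E] (s c : ℝ) (A : Set E) : Prop :=
  ∀ F : Finset (E × ℝ), (∀ q ∈ F, 0 < q.2) → A ⊆ ⋃ q ∈ F, closedBall q.1 q.2 →
    c ≤ ∑ q ∈ F, q.2 ^ s

lemma exists_isCompact_ballContentGE {t : ℝ} (ht : 0 < t) {Y : Set (ℝ × ℝ)}
    (hYm : MeasurableSet Y) (hY : μH[t] Y ≠ 0) :
    ∃ K ⊆ Y, IsCompact K ∧ ∃ c > 0, BallContentGE t c K := by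
  obtain ⟨c, hc0, hc⟩ := ENNReal.lt_iff_exists_nnreal_btwn.1
    (pos_iff_ne_zero.2 (netContent_dyadic_ne_zero ht hY))
  obtain ⟨K, hKY, hK, hKU⟩ := AnalyticSet.exists_isCompact_forall_isOpen_lt
    (M := netContent dyadicSquare (dyadicWeight t)) (fun _ _ => netContent_mono)
    (fun A c hA => netContent_iUnion_le dyadicSquare_nested hA) hYm.analyticSet hc
  have hcpos : (0 : ℝ) < c := by exact_mod_cast hc0
  refine ⟨K, hKY, hK, min ((1 / 4) ^ t) (c / (4 * 8 ^ t)), by positivity, ?_⟩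
  intro F hF hcov
  by_cases hbig : ∃ q ∈ F, 1 / 4 ≤ q.2
  · obtain ⟨q, hq, hq4⟩ := hbig
    refine (min_le_left _ _).trans ?_
    calc (1 / 4 : ℝ) ^ t ≤ q.2 ^ t := by gcongr
      _ ≤ _ := Finset.single_le_sum (f := fun q : (ℝ × ℝ) × ℝ => q.2 ^ t)
          (fun i hi => (Real.rpow_pos_of_pos (hF i hi) _).le) hq
  · push Not at hbig
    refine (min_le_right _ _).trans ?_
    have h1 := hKU (⋃ q : F, ball q.1.1 (2 * q.1.2)) (isOpen_iUnion fun _ => isOpen_ball) (by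
      refine hcov.trans ?_
      rw [iUnion_subtype]
      refine iUnion₂_mono fun q hq => closedBall_subset_ball ?_
      linarith [hF q hq])
    have h2 := h1.le.trans (netContent_iUnion_le_tsum _)
    have h3 : ∀ q ∈ F, netContent dyadicSquare (dyadicWeight t) (ball q.1 (2 * q.2)) ≤
        ENNReal.ofReal (4 * (8 * q.2) ^ t) := by
      intro q hq
      have hq0 := hF q hq
      obtain ⟨k, hk1, hk2⟩ := exists_nat_pow_near_of_lt_one (x := 4 * q.2) (y := (1 / 2 : ℝ))
        (by linarith) (by linarith [hbig q hq]) (by norm_num) (by norm_num)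
      have e : ((1 : ℝ) / 2) ^ k = ((2 : ℝ) ^ k)⁻¹ := by rw [one_div, inv_pow]
      refine (netContent_ball_le (k := k) (by rw [← e]; linarith)).trans ?_
      rw [ENNReal.ofReal_mul (by norm_num), ENNReal.ofReal_ofNat]
      gcongr
      rw [← e]
      rw [pow_succ] at hk1
      linarith
    rw [tsum_fintype, Finset.univ_eq_attach,
      Finset.sum_attach F (fun q => netContent dyadicSquare (dyadicWeight t) (ball q.1 (2 * q.2)))]
      at h2
    have h4 := h2.trans (Finset.sum_le_sum h3)
    rw [← ENNReal.ofReal_sum_of_nonneg (fun q hq => by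
      have := hF q hq
      positivity), ← ENNReal.ofReal_coe_nnreal] at h4
    have h5 := (ENNReal.ofReal_le_ofReal_iff (Finset.sum_nonneg fun q hq => by
      have := hF q hq
      positivity)).1 h4
    rw [div_le_iff₀ (by positivity), Finset.sum_mul]
    refine h5.trans (le_of_eq (Finset.sum_congr rfl fun q hq => ?_))
    rw [Real.mul_rpow (by norm_num) (hF q hq).le]
    ring

/-- Quantitative countable stability of positive ball content. -/
lemma exists_ballContentGE_of_subset_iUnion {E : Type} [MetricSpace E] [MeasurableSpace E]
    [BorelSpace E] {s : ℝ} (hs : 0 ≤ s) {A : Set E} (hA : μH[s] A ≠ 0) {b : ℕ → ℝ}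
    (hb : ∀ j, 0 < b j) (hbs : Summable b) :
    ∃ c > 0, ∀ X : ℕ → Set E, A ⊆ ⋃ j, X j → ∃ j, BallContentGE s (c * b j) (X j) := by
  have hB : ∀ j, b j ≤ ∑' j, b j := fun j => hbs.le_tsum j fun i _ => (hb i).le
  have hBpos : 0 < ∑' j, b j := (hb 0).trans_le (hB 0)
  rcases hs.eq_or_lt with rfl | hs
  · refine ⟨1 / ∑' j, b j, by positivity, fun X hX => ?_⟩
    obtain ⟨x, hx⟩ : A.Nonempty := by
      rw [nonempty_iff_ne_empty]
      rintro rfl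
      simp at hA
    obtain ⟨j, hj⟩ := mem_iUnion.1 (hX hx)
    refine ⟨j, fun F hF hcov => ?_⟩
    obtain ⟨q, hq, -⟩ := mem_iUnion₂.1 (hcov hj)
    simp only [Real.rpow_zero, Finset.sum_const, nsmul_eq_mul, mul_one]
    have h1 : (1 : ℝ) ≤ F.card := by exact_mod_cast Finset.card_pos.2 ⟨q, hq⟩
    refine le_trans ?_ h1
    rw [one_div_mul_eq_div, div_le_one hBpos]
    exact hB j
  · by_contra! hcon
    refine hA (hausdorffMeasure_eq_zero_of_forall_cover hs fun ε hε => ?_)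
    obtain ⟨c, hc0, hc⟩ : ∃ c : ℝ, 0 < c ∧ ENNReal.ofReal (2 ^ s * (c * ∑' j, b j)) ≤ ε := by
      obtain ⟨e, he0, he⟩ := ENNReal.lt_iff_exists_nnreal_btwn.1 (pos_iff_ne_zero.2 hε)
      have he0' : (0 : ℝ) < e := by exact_mod_cast he0
      refine ⟨e / (2 ^ s * ∑' j, b j), by positivity, ?_⟩
      refine le_trans (le_of_eq ?_) he.le
      rw [← ENNReal.ofReal_coe_nnreal]
      congr 1
      have : (2 : ℝ) ^ s ≠ 0 := by positivity
      field_simp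
    obtain ⟨X, hAX, hX⟩ := hcon c hc0
    have hX' : ∀ j, ∃ F : Finset (E × ℝ), (∀ q ∈ F, 0 < q.2) ∧
        X j ⊆ ⋃ q ∈ F, closedBall q.1 q.2 ∧ ∑ q ∈ F, q.2 ^ s < c * b j := by
      intro j
      have := hX j
      unfold BallContentGE at this
      push Not at this
      exact this
    choose F hF hcov hsum using hX'
    refine ⟨Σ j, F j, inferInstance, fun i => closedBall i.2.1.1 i.2.1.2, ?_, ?_⟩
    · intro x hx
      obtain ⟨j, hj⟩ := mem_iUnion.1 (hAX hx)
      obtain ⟨q, hq, hxq⟩ := mem_iUnion₂.1 (hcov j hj)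
      exact mem_iUnion.2 ⟨⟨j, q, hq⟩, hxq⟩
    · have hdiam : ∀ (p : E) (r : ℝ), 0 < r →
          ediam (closedBall p r) ^ s ≤ ENNReal.ofReal (2 ^ s * r ^ s) := by
        intro p r hr
        have h1 : ediam (closedBall p r) ≤ ENNReal.ofReal (2 * r) :=
          ediam_le fun x hx y hy => by
            rw [edist_dist]
            refine ENNReal.ofReal_le_ofReal ?_
            linarith [dist_triangle_right x y p, mem_closedBall.1 hx, mem_closedBall.1 hy]
        refine (ENNReal.rpow_le_rpow h1 hs.le).trans ?_
        rw [ENNReal.ofReal_rpow_of_pos (by positivity), Real.mul_rpow (by norm_num) hr.le]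
      rw [ENNReal.tsum_sigma']
      calc ∑' j, ∑' q : F j, ediam (closedBall q.1.1 q.1.2) ^ s
          ≤ ∑' j, ENNReal.ofReal (2 ^ s * (c * b j)) := by
            refine ENNReal.tsum_le_tsum fun j => ?_
            rw [tsum_fintype, Finset.univ_eq_attach,
              Finset.sum_attach (F j) (fun q => ediam (closedBall q.1 q.2) ^ s)]
            calc _ ≤ ∑ q ∈ F j, ENNReal.ofReal (2 ^ s * q.2 ^ s) :=
                  Finset.sum_le_sum fun q hq => hdiam _ _ (hF j q hq)
              _ = ENNReal.ofReal (∑ q ∈ F j, 2 ^ s * q.2 ^ s) :=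
                  (ENNReal.ofReal_sum_of_nonneg fun q hq => by
                    have := hF j q hq
                    positivity).symm
              _ ≤ _ := by
                  refine ENNReal.ofReal_le_ofReal ?_
                  rw [← Finset.mul_sum]
                  gcongr
                  exact (hsum j).le
        _ = ENNReal.ofReal (∑' j, 2 ^ s * (c * b j)) :=
            (ENNReal.ofReal_tsum_of_nonneg (fun j => by have := hb j; positivity)
              ((hbs.mul_left c).mul_left _)).symm
        _ ≤ ε := by rwa [tsum_mul_left, tsum_mul_left]

/-- Finite maximal mass distributions: every point lies in a saturated ball. -/
lemma exists_saturated_weights {E : Type*} [MetricSpace E] (P : Finset E) {s Δ : ℝ}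
    (hΔ : 0 < Δ) :
    ∃ w : E → ℝ, (∀ p, 0 ≤ w p) ∧
      (∀ p ∈ P, ∀ q ∈ P, ∑ z ∈ P with dist z p ≤ max Δ (dist q p), w z ≤ max Δ (dist q p) ^ s) ∧
      ∀ z ∈ P, ∃ p ∈ P, ∃ q ∈ P, dist z p ≤ max Δ (dist q p) ∧
        ∑ z ∈ P with dist z p ≤ max Δ (dist q p), w z = max Δ (dist q p) ^ s := by
  classical
  let B : Set (E → ℝ) := Set.pi univ fun e => Icc 0 (if e ∈ P then Δ ^ s else 0)
  have hB : IsCompact B := isCompact_univ_pi fun _ => isCompact_Icc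
  let W : Set (E → ℝ) := {w | ∀ p ∈ P, ∀ q ∈ P,
    ∑ z ∈ P with dist z p ≤ max Δ (dist q p), w z ≤ max Δ (dist q p) ^ s}
  have hW : IsClosed W := by
    simp only [W, ofPred_forall]
    refine isClosed_iInter fun p => isClosed_iInter fun _ => isClosed_iInter fun q =>
      isClosed_iInter fun _ => isClosed_le ?_ continuous_const
    exact continuous_finsetSum _ fun z _ => continuous_apply z
  obtain ⟨w, ⟨hwB, hwW⟩, hmax⟩ := (hB.inter_right hW).exists_isMaxOn
    ⟨0, fun e _ => ⟨le_rfl, by simp only [Pi.zero_apply]; split_ifs <;> positivity⟩,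
      fun p _ q _ => by simpa using by positivity⟩
    (continuous_finsetSum P fun z _ => continuous_apply z).continuousOn
  refine ⟨w, fun p => (hwB p trivial).1, hwW, ?_⟩
  intro z hz
  by_contra! hcon
  have hev : ∀ᶠ ε in nhdsWithin (0 : ℝ) (Ioi 0), ∀ p ∈ P, ∀ q ∈ P, dist z p ≤ max Δ (dist q p) →
      (∑ z ∈ P with dist z p ≤ max Δ (dist q p), w z) + ε ≤ max Δ (dist q p) ^ s := by
    refine (Finset.eventually_all P).2 fun p hp => (Finset.eventually_all P).2 fun q hq => ?_
    by_cases h : dist z p ≤ max Δ (dist q p)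
    · have hlt := lt_of_le_of_ne (hwW p hp q hq) (hcon p hp q hq h)
      have := (eventually_le_nhds (sub_pos.2 hlt)).filter_mono
        (nhdsWithin_le_nhds (s := Ioi (0 : ℝ)))
      filter_upwards [this] with ε hε _
      linarith
    · exact Filter.Eventually.of_forall fun _ h' => absurd h' h
  obtain ⟨ε, hε, hε0⟩ := (hev.and self_mem_nhdsWithin).exists
  have hε0 : 0 < ε := hε0
  have hsum : ∀ S : Finset E, ∑ e ∈ S, Function.update w z (w z + ε) e =
      (∑ e ∈ S, w e) + if z ∈ S then ε else 0 := by
    intro S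
    split_ifs with h
    · rw [Finset.sum_update_of_mem h, ← Finset.add_sum_erase S w h, Finset.sdiff_singleton_eq_erase]
      ring
    · rw [Finset.sum_update_of_notMem h, add_zero]
  have hW' : Function.update w z (w z + ε) ∈ W := by
    intro p hp q hq
    rw [hsum]
    split_ifs with h
    · exact hε p hp q hq (Finset.mem_filter.1 h).2
    · rw [add_zero]; exact hwW p hp q hq
  have hB' : Function.update w z (w z + ε) ∈ B := by
    intro e _
    by_cases he : e = z
    · subst he
      rw [Function.update_self]
      simp only [if_pos hz]
      refine ⟨by linarith [(hwB e trivial).1], ?_⟩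
      have h1 := hW' e hz e hz
      rw [dist_self, max_eq_left hΔ.le] at h1
      refine le_trans ?_ h1
      rw [hsum, if_pos (Finset.mem_filter.2 ⟨hz, by simpa using hΔ.le⟩)]
      gcongr
      exact Finset.single_le_sum (f := w) (fun i _ => (hwB i trivial).1)
        (Finset.mem_filter.2 ⟨hz, by simpa using hΔ.le⟩)
    · rw [Function.update_of_ne he]
      exact hwB e trivial
  have := hmax ⟨hB', hW'⟩
  simp only [mem_ofPred_eq] at this
  rw [hsum, if_pos hz] at this
  linarith

/-- Discrete Frostman lemma. -/
lemma exists_discrete_frostman {E : Type*} [MetricSpace E] {s c : ℝ} (hs : 0 ≤ s) (hc : 0 < c)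
    {A : Set E} (hA : TotallyBounded A) (hcA : BallContentGE s c A) {Δ : ℝ} (hΔ : 0 < Δ) :
    ∃ (P : Finset E) (w : E → ℝ), (P : Set E) ⊆ A ∧ (∀ p, 0 ≤ w p) ∧ ∑ p ∈ P, w p = 1 ∧
      ∀ p ∈ P, ∀ r, Δ ≤ r → ∑ q ∈ P with dist q p ≤ r, w q ≤ 6 ^ s / c * r ^ s := by
  classical
  obtain ⟨t, htA, htfin, hcov⟩ := finite_approx_of_totallyBounded hA Δ hΔ
  lift t to Finset E using htfin
  rename' t => P
  obtain ⟨w, hw0, hwle, hsat⟩ := exists_saturated_weights P (s := s) hΔ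
  set rad : E × E → ℝ := fun i => max Δ (dist i.2 i.1) with hrad
  have hradpos : ∀ i, 0 < rad i := fun i => hΔ.trans_le (le_max_left _ _)
  let T : Set (E × E) := {i | i ∈ P ×ˢ P ∧ ∑ z ∈ P with dist z i.1 ≤ rad i, w z = rad i ^ s}
  have hTfin : T.Finite := (P ×ˢ P).finite_toSet.subset fun i hi => hi.1
  obtain ⟨R, hR⟩ : ∃ R, ∀ i ∈ T, rad i ≤ R := (hTfin.image rad).bddAbove.imp fun R hR i hi =>
    hR ⟨i, hi, rfl⟩
  obtain ⟨u, huT, hudisj, hucov⟩ := Vitali.exists_disjoint_subfamily_covering_enlargement_closedBall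
    T Prod.fst rad R hR 5 (by norm_num)
  have hufin := hTfin.subset huT
  lift u to Finset (E × E) using hufin
  have hWc : c ≤ 6 ^ s * ∑ p ∈ P, w p := by
    calc c ≤ ∑ q ∈ u.image fun i => (i.1, 6 * rad i), q.2 ^ s := by
          refine hcA _ ?_ ?_
          · intro q hq
            obtain ⟨i, -, rfl⟩ := Finset.mem_image.1 hq
            have := hradpos i
            positivity
          · intro a ha
            obtain ⟨p, hp, hap⟩ := mem_iUnion₂.1 (hcov ha)
            obtain ⟨p', hp', q', hq', hd, hsum⟩ := hsat p hp
            obtain ⟨i, hi, hsub⟩ := hucov (p', q') ⟨Finset.mk_mem_product hp' hq', hsum⟩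
            have h1 := hsub (mem_closedBall.2 hd)
            refine mem_iUnion₂.2 ⟨(i.1, 6 * rad i), Finset.mem_image_of_mem _ hi, ?_⟩
            simp only [mem_closedBall, mem_ball] at h1 hap ⊢
            have := dist_triangle a p i.1
            have h2 : Δ ≤ rad i := le_max_left _ _
            linarith
      _ ≤ ∑ i ∈ u, (6 * rad i) ^ s := Finset.sum_image_le_of_nonneg fun q hq => by
          obtain ⟨i, -, rfl⟩ := Finset.mem_image.1 hq
          have := hradpos i
          positivity
      _ = 6 ^ s * ∑ i ∈ u, ∑ z ∈ P with dist z i.1 ≤ rad i, w z := by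
          rw [Finset.mul_sum]
          refine Finset.sum_congr rfl fun i hi => ?_
          rw [Real.mul_rpow (by norm_num) (hradpos i).le, (huT hi).2]
      _ ≤ 6 ^ s * ∑ p ∈ P, w p := by
          gcongr
          rw [← Finset.sum_biUnion]
          · refine Finset.sum_le_sum_of_subset_of_nonneg ?_ fun i _ _ => hw0 i
            exact Finset.biUnion_subset.2 fun i _ => Finset.filter_subset _ _
          · intro i hi j hj hij
            have h := hudisj hi hj hij
            rw [Function.onFun, Finset.disjoint_left]
            intro z hz hz'
            exact Set.disjoint_left.1 h (mem_closedBall.2 (Finset.mem_filter.1 hz).2)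
              (mem_closedBall.2 (Finset.mem_filter.1 hz').2)
  have h6 : (0 : ℝ) < 6 ^ s := by positivity
  have hW : 0 < ∑ p ∈ P, w p := by
    by_contra! h
    nlinarith
  refine ⟨P, fun p => w p / ∑ p ∈ P, w p, htA, fun p => by have := hw0 p; positivity, ?_, ?_⟩
  · rw [← Finset.sum_div, div_self hW.ne']
  · intro p hp r hr
    rw [← Finset.sum_div, div_le_iff₀ hW]
    have h1 : ∑ q ∈ P with dist q p ≤ r, w q ≤ r ^ s := by
      have hne : (P.filter fun q => dist q p ≤ r).Nonempty :=
        ⟨p, Finset.mem_filter.2 ⟨hp, by simpa using hΔ.le.trans hr⟩⟩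
      obtain ⟨q, hq, hqmax⟩ := Finset.exists_max_image _ (fun q => dist q p) hne
      obtain ⟨hqP, hqr⟩ := Finset.mem_filter.1 hq
      calc ∑ q ∈ P with dist q p ≤ r, w q
          ≤ ∑ z ∈ P with dist z p ≤ max Δ (dist q p), w z := by
            refine Finset.sum_le_sum_of_subset_of_nonneg (fun z hz => ?_) fun i _ _ => hw0 i
            exact Finset.mem_filter.2 ⟨(Finset.mem_filter.1 hz).1,
              (hqmax z hz).trans (le_max_right _ _)⟩
        _ ≤ max Δ (dist q p) ^ s := hwle p hp q hqP
        _ ≤ r ^ s := by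
            have : 0 ≤ max Δ (dist q p) := hΔ.le.trans (le_max_left _ _)
            gcongr
            exact max_le hr hqr
    refine h1.trans ?_
    have hr0 : 0 ≤ r ^ s := Real.rpow_nonneg (hΔ.le.trans hr) _
    calc r ^ s = c / c * r ^ s := by rw [div_self hc.ne', one_mul]
      _ ≤ (6 ^ s * ∑ p ∈ P, w p) / c * r ^ s := by gcongr
      _ = _ := by ring

/-- Frostman's lemma on compact sets, from a lower bound on ball content. -/
lemma exists_frostman_measure {E : Type*} [MetricSpace E] [MeasurableSpace E] [BorelSpace E]
    {t c : ℝ} (ht : 0 ≤ t) (hc : 0 < c) {K : Set E} (hK : IsCompact K)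
    (hKc : BallContentGE t c K) :
    ∃ C > 0, ∃ ν : Measure E, IsProbabilityMeasure ν ∧ ν Kᶜ = 0 ∧
      ∀ p r, 0 < r → ν (closedBall p r) ≤ ENNReal.ofReal (C * r ^ t) := by
  classical
  have hΔ : ∀ n : ℕ, (0 : ℝ) < 1 / (n + 1) := fun n => by positivity
  choose P w hPK hw0 hw1 hreg using fun n : ℕ =>
    exists_discrete_frostman ht hc hK.totallyBounded hKc (hΔ n)
  have : CompactSpace K := isCompact_iff_compactSpace.1 hK
  let m : ℕ → Measure K := fun n =>
    ∑ p ∈ (P n).attach, ENNReal.ofReal (w n p) • Measure.dirac ⟨p.1, hPK n p.2⟩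
  have hmapply : ∀ n (S : Set K), MeasurableSet S →
      m n S = ENNReal.ofReal (∑ p ∈ P n with p ∈ (Subtype.val '' S), w n p) := by
    intro n S hS
    simp only [m, Measure.coe_finsetSum, Finset.sum_apply, Measure.smul_apply, smul_eq_mul,
      Measure.dirac_apply' _ hS]
    rw [ENNReal.ofReal_sum_of_nonneg (fun i _ => hw0 n i), Finset.sum_filter,
      ← Finset.sum_attach (P n)]
    refine Finset.sum_congr rfl fun p _ => ?_
    have : (p : E) ∈ (Subtype.val '' S) ↔ (⟨p.1, hPK n p.2⟩ : K) ∈ S := by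
      constructor
      · rintro ⟨q, hq, h⟩
        have : q = ⟨p.1, hPK n p.2⟩ := Subtype.ext h
        rwa [← this]
      · intro h
        exact ⟨_, h, rfl⟩
    by_cases h : (⟨p.1, hPK n p.2⟩ : K) ∈ S
    · rw [if_pos (this.2 h), indicator_of_mem h, Pi.one_apply, mul_one]
    · rw [if_neg (fun h' => h (this.1 h')), indicator_of_notMem h, mul_zero]
  have hmprob : ∀ n, IsProbabilityMeasure (m n) := by
    refine fun n => ⟨?_⟩
    rw [hmapply n _ MeasurableSet.univ]
    have : (P n).filter (fun p => p ∈ (Subtype.val '' (univ : Set K))) = P n := by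
      refine Finset.filter_true_of_mem fun p hp => ?_
      simpa using hPK n hp
    rw [this, hw1, ENNReal.ofReal_one]
  let M : ℕ → ProbabilityMeasure K := fun n => ⟨m n, hmprob n⟩
  obtain ⟨μ, -, hμ⟩ := (isCompact_univ (X := ProbabilityMeasure K)).ultrafilter_le_nhds
    ((Filter.hyperfilter ℕ).map M) (by simp)
  have hlim : Filter.Tendsto M (Filter.hyperfilter ℕ : Filter ℕ) (nhds μ) := hμ
  refine ⟨6 ^ t / c * 4 ^ t, by positivity, (μ : Measure K).map Subtype.val,
    Measure.isProbabilityMeasure_map measurable_subtype_coe.aemeasurable, ?_, ?_⟩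
  · rw [Measure.map_apply measurable_subtype_coe hK.measurableSet.compl]
    simp
  · intro p r hr
    rw [Measure.map_apply measurable_subtype_coe isClosed_closedBall.measurableSet]
    let G : Set K := Subtype.val ⁻¹' ball p (2 * r)
    have hG : IsOpen G := isOpen_ball.preimage continuous_subtype_val
    have h1 : (μ : Measure K) (Subtype.val ⁻¹' closedBall p r) ≤ (μ : Measure K) G :=
      measure_mono (preimage_mono (closedBall_subset_ball (by linarith)))
    refine h1.trans ((ProbabilityMeasure.le_liminf_measure_open_of_tendsto hlim hG).trans ?_)
    have hev : ∀ᶠ n : ℕ in (Filter.hyperfilter ℕ : Filter ℕ), (1 : ℝ) / (n + 1) ≤ r := by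
      refine Filter.Eventually.filter_mono Nat.hyperfilter_le_atTop ?_
      exact (tendsto_one_div_add_atTop_nhds_zero_nat.eventually (eventually_le_nhds hr))
    refine Filter.liminf_le_of_frequently_le' (hev.mono fun n hn => ?_).frequently
    change m n G ≤ _
    rw [hmapply n _ hG.measurableSet]
    refine ENNReal.ofReal_le_ofReal ?_
    by_cases hne : ∃ q ∈ P n, dist q p < 2 * r
    · obtain ⟨q, hq, hqp⟩ := hne
      refine (Finset.sum_le_sum_of_subset_of_nonneg (fun z hz => ?_) fun i _ _ => hw0 n i).trans
        ((hreg n q hq (4 * r) (by linarith)).trans (le_of_eq ?_))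
      · obtain ⟨hzP, y, hy, rfl⟩ := Finset.mem_filter.1 hz
        have hy' : dist (y : E) p < 2 * r := hy
        refine Finset.mem_filter.2 ⟨hzP, ?_⟩
        linarith [dist_triangle_right (y : E) q p]
      · rw [Real.mul_rpow (by norm_num) hr.le]
        ring
    · push Not at hne
      rw [Finset.sum_eq_zero]
      · positivity
      · intro z hz
        obtain ⟨hzP, y, hy, rfl⟩ := Finset.mem_filter.1 hz
        have hy' : dist (y : E) p < 2 * r := hy
        linarith [hne _ hzP]

/-- Truncated Riesz potentials of measures with `t`-dimensional growth above scale `Δ`. -/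
lemma lintegral_max_rpow_neg_le {E : Type*} [PseudoMetricSpace E] [MeasurableSpace E]
    [OpensMeasurableSpace E] {ν : Measure E} {p : E} {Δ C t α : ℝ} (hΔ : 0 < Δ) (hC : 0 ≤ C)
    (hα : 0 ≤ α) (htα : t < α)
    (hν : ∀ r, Δ ≤ r → ν (closedBall p r) ≤ ENNReal.ofReal (C * r ^ t)) :
    ∫⁻ z, ENNReal.ofReal (max Δ (dist z p) ^ (-α)) ∂ν ≤
      ENNReal.ofReal (2 ^ α / (1 - 2 ^ (t - α)) * C * Δ ^ (t - α)) := by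
  have hq0 : (0 : ℝ) < 2 ^ (t - α) := by positivity
  have hq1 : (2 : ℝ) ^ (t - α) < 1 := Real.rpow_lt_one_of_one_lt_of_neg (by norm_num) (by linarith)
  have hpt : ∀ z, ENNReal.ofReal (max Δ (dist z p) ^ (-α)) ≤
      ∑' j : ℕ, (closedBall p (2 ^ j * Δ)).indicator
        (fun _ => ENNReal.ofReal (2 ^ α * (2 ^ j * Δ) ^ (-α))) z := by
    intro z
    obtain ⟨j, hj, hj'⟩ : ∃ j : ℕ, dist z p ≤ 2 ^ j * Δ ∧ 2 ^ j * Δ ≤ 2 * max Δ (dist z p) := by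
      have hex : ∃ j : ℕ, dist z p ≤ 2 ^ j * Δ := by
        obtain ⟨j, hj⟩ := pow_unbounded_of_one_lt (dist z p / Δ) (one_lt_two : (1 : ℝ) < 2)
        exact ⟨j, by rw [div_lt_iff₀ hΔ] at hj; exact hj.le⟩
      classical
      refine ⟨Nat.find hex, Nat.find_spec hex, ?_⟩
      rcases h : Nat.find hex with _ | k
      · have := le_max_left Δ (dist z p)
        simp only [pow_zero, one_mul]
        linarith
      · have := Nat.find_min hex (m := k) (by omega)
        have h2 := le_max_right Δ (dist z p)
        rw [pow_succ]
        linarith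
    refine le_trans ?_ (ENNReal.le_tsum j)
    rw [indicator_of_mem (mem_closedBall.2 hj)]
    refine ENNReal.ofReal_le_ofReal ?_
    have hm : 0 < max Δ (dist z p) := hΔ.trans_le (le_max_left _ _)
    calc max Δ (dist z p) ^ (-α) = 2 ^ α * (2 * max Δ (dist z p)) ^ (-α) := by
          rw [Real.mul_rpow (by norm_num) hm.le, ← mul_assoc, ← Real.rpow_add (by norm_num)]
          simp
      _ ≤ 2 ^ α * (2 ^ j * Δ) ^ (-α) := by
          gcongr ?_ * ?_
          exact Real.rpow_le_rpow_of_nonpos (by positivity) hj' (by linarith)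
  calc ∫⁻ z, ENNReal.ofReal (max Δ (dist z p) ^ (-α)) ∂ν
      ≤ ∫⁻ z, ∑' j : ℕ, (closedBall p (2 ^ j * Δ)).indicator
        (fun _ => ENNReal.ofReal (2 ^ α * (2 ^ j * Δ) ^ (-α))) z ∂ν := lintegral_mono hpt
    _ = ∑' j : ℕ, ENNReal.ofReal (2 ^ α * (2 ^ j * Δ) ^ (-α)) * ν (closedBall p (2 ^ j * Δ)) := by
        rw [lintegral_tsum fun j =>
          (measurable_const.indicator isClosed_closedBall.measurableSet).aemeasurable]
        refine tsum_congr fun j => ?_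
        rw [lintegral_indicator isClosed_closedBall.measurableSet, setLIntegral_const]
    _ ≤ ∑' j : ℕ, ENNReal.ofReal (2 ^ α * C * Δ ^ (t - α) * (2 ^ (t - α)) ^ j) := by
        refine ENNReal.tsum_le_tsum fun j => ?_
        have h1 : Δ ≤ 2 ^ j * Δ := le_mul_of_one_le_left hΔ.le (one_le_pow₀ (by norm_num))
        refine (mul_le_mul_right (hν _ h1) _).trans (le_of_eq ?_)
        rw [← ENNReal.ofReal_mul (by positivity)]
        congr 1
        have h2 : ((2 : ℝ) ^ j * Δ) ^ (-α) * (2 ^ j * Δ) ^ t = Δ ^ (t - α) * (2 ^ (t - α)) ^ j := by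
          rw [← Real.rpow_add (by positivity), Real.mul_rpow (by positivity) hΔ.le,
            ← Real.rpow_natCast, ← Real.rpow_natCast, ← Real.rpow_mul (by norm_num),
            ← Real.rpow_mul (by norm_num)]
          ring_nf
        linear_combination 2 ^ α * C * h2
    _ = ENNReal.ofReal (∑' j : ℕ, 2 ^ α * C * Δ ^ (t - α) * (2 ^ (t - α)) ^ j) :=
        (ENNReal.ofReal_tsum_of_nonneg (fun j => by positivity)
          ((summable_geometric_of_lt_one hq0.le hq1).mul_left _)).symm
    _ = _ := by
        rw [tsum_mul_left, tsum_geometric_of_lt_one hq0.le hq1]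
        congr 1
        ring

/-- The standard tent function. -/
def hat (τ : ℝ) : ℝ := max 0 (1 - |τ|)

/-- The tent function of unit mass on `[-Δ, Δ]`. -/
def tent (Δ τ : ℝ) : ℝ := Δ⁻¹ * hat (τ / Δ)

/-- Difference of tents at consecutive dyadic scales. -/
def tentDiff (Δ τ : ℝ) : ℝ := tent Δ τ - tent (2 * Δ) τ

lemma hat_nonneg (τ : ℝ) : 0 ≤ hat τ := le_max_left _ _

lemma hat_le_one (τ : ℝ) : hat τ ≤ 1 := max_le zero_le_one (by linarith [abs_nonneg τ])

lemma hat_eq_zero {τ : ℝ} (h : 1 ≤ |τ|) : hat τ = 0 := max_eq_left (by linarith)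

lemma half_le_hat {τ : ℝ} (h : |τ| ≤ 1 / 2) : 1 / 2 ≤ hat τ := le_max_of_le_right (by linarith)

lemma abs_hat_sub_hat_le (τ τ' : ℝ) : |hat τ - hat τ'| ≤ |τ - τ'| := by
  unfold hat
  rw [max_comm 0, max_comm 0]
  refine (abs_max_sub_max_le_abs _ _ _).trans ?_
  rw [sub_sub_sub_cancel_left, abs_sub_comm τ τ']
  exact abs_abs_sub_abs_le _ _

lemma continuous_hat : Continuous hat := by unfold hat; fun_prop

lemma continuous_tent (Δ : ℝ) : Continuous (tent Δ) := by
  have := continuous_hat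
  unfold tent
  fun_prop

lemma continuous_tentDiff (Δ : ℝ) : Continuous (tentDiff Δ) :=
  (continuous_tent _).sub (continuous_tent _)

section

variable {Δ : ℝ}

lemma tent_nonneg (hΔ : 0 < Δ) (τ : ℝ) : 0 ≤ tent Δ τ := mul_nonneg (by positivity) (hat_nonneg _)

lemma tent_le (hΔ : 0 < Δ) (τ : ℝ) : tent Δ τ ≤ Δ⁻¹ :=
  mul_le_of_le_one_right (by positivity) (hat_le_one _)

lemma tent_eq_zero (hΔ : 0 < Δ) {τ : ℝ} (h : Δ ≤ |τ|) : tent Δ τ = 0 := by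
  rw [tent, hat_eq_zero, mul_zero]
  rwa [abs_div, abs_of_pos hΔ, one_le_div hΔ]

lemma le_tent (hΔ : 0 < Δ) {τ : ℝ} (h : |τ| ≤ Δ / 2) : Δ⁻¹ / 2 ≤ tent Δ τ := by
  have := half_le_hat (τ := τ / Δ) (by rw [abs_div, abs_of_pos hΔ, div_le_iff₀ hΔ]; linarith)
  have h2 : 0 < Δ⁻¹ := by positivity
  unfold tent
  nlinarith

lemma abs_tent_sub_tent_le (hΔ : 0 < Δ) (τ τ' : ℝ) :
    |tent Δ τ - tent Δ τ'| ≤ Δ⁻¹ ^ 2 * |τ - τ'| := by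
  unfold tent
  rw [← mul_sub, abs_mul, abs_of_pos (inv_pos.2 hΔ)]
  have := abs_hat_sub_hat_le (τ / Δ) (τ' / Δ)
  rw [← sub_div, abs_div, abs_of_pos hΔ] at this
  calc Δ⁻¹ * |hat (τ / Δ) - hat (τ' / Δ)| ≤ Δ⁻¹ * (|τ - τ'| / Δ) := by gcongr
    _ = _ := by field_simp

lemma integral_tent (hΔ : 0 < Δ) : ∫ τ, tent Δ τ = ∫ τ, hat τ := by
  unfold tent
  rw [integral_const_mul, Measure.integral_comp_div, abs_of_pos hΔ, smul_eq_mul, ← mul_assoc,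
    inv_mul_cancel₀ hΔ.ne', one_mul]

lemma integrable_tent (hΔ : 0 < Δ) : Integrable (tent Δ) :=
  (continuous_tent Δ).integrable_of_hasCompactSupport <|
    HasCompactSupport.intro (isCompact_Icc (a := -Δ) (b := Δ)) fun τ hτ =>
      tent_eq_zero hΔ (by
        by_contra! h
        exact hτ (abs_le.1 h.le))

lemma integral_tentDiff (hΔ : 0 < Δ) : ∫ τ, tentDiff Δ τ = 0 := by
  have h2 : 0 < 2 * Δ := by positivity
  unfold tentDiff
  rw [integral_sub (integrable_tent hΔ) (integrable_tent h2), integral_tent hΔ, integral_tent h2,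
    sub_self]

lemma tentDiff_eq_zero (hΔ : 0 < Δ) {τ : ℝ} (h : 2 * Δ ≤ |τ|) : tentDiff Δ τ = 0 := by
  rw [tentDiff, tent_eq_zero hΔ (by linarith), tent_eq_zero (by positivity) h, sub_self]

lemma abs_tentDiff_le (hΔ : 0 < Δ) (τ : ℝ) : |tentDiff Δ τ| ≤ Δ⁻¹ := by
  have h2 : 0 < 2 * Δ := by positivity
  have h3 : (2 * Δ)⁻¹ ≤ Δ⁻¹ := by gcongr; linarith
  unfold tentDiff
  rw [abs_le]
  constructor <;> linarith [tent_nonneg hΔ τ, tent_le hΔ τ, tent_nonneg h2 τ, tent_le h2 τ]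

lemma abs_tentDiff_sub_le (hΔ : 0 < Δ) (τ τ' : ℝ) :
    |tentDiff Δ τ - tentDiff Δ τ'| ≤ 2 * Δ⁻¹ ^ 2 * |τ - τ'| := by
  have h2 : 0 < 2 * Δ := by positivity
  have h3 : (2 * Δ)⁻¹ ≤ Δ⁻¹ := by gcongr; linarith
  have h4 : (2 * Δ)⁻¹ ^ 2 * |τ - τ'| ≤ Δ⁻¹ ^ 2 * |τ - τ'| := by gcongr
  have h5 := abs_tent_sub_tent_le hΔ τ τ'
  have h6 := abs_tent_sub_tent_le h2 τ τ'
  unfold tentDiff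
  rw [abs_le] at h5 h6 ⊢
  constructor <;> linarith

/-- The autocorrelation of `tentDiff`. -/
def tentCorr (Δ s : ℝ) : ℝ := ∫ b, tentDiff Δ b * tentDiff Δ (b + s)

lemma tentDiff_mul_eq_zero (hΔ : 0 < Δ) {b s : ℝ} (h : b ∉ Icc (-(2 * Δ)) (2 * Δ)) :
    tentDiff Δ b * tentDiff Δ (b + s) = 0 := by
  rw [tentDiff_eq_zero hΔ, zero_mul]
  by_contra! h'
  exact h (abs_le.1 h'.le)

lemma abs_tentCorr_le (hΔ : 0 < Δ) (s : ℝ) : |tentCorr Δ s| ≤ 4 * Δ⁻¹ := by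
  unfold tentCorr
  rw [← setIntegral_eq_integral_of_forall_compl_eq_zero
    (s := Icc (-(2 * Δ)) (2 * Δ)) fun b hb => tentDiff_mul_eq_zero hΔ hb, ← Real.norm_eq_abs]
  refine (norm_setIntegral_le_of_norm_le_const (C := Δ⁻¹ * Δ⁻¹) (by simp) fun b _ => ?_).trans
    (le_of_eq ?_)
  · rw [norm_mul]
    gcongr
    exacts [abs_tentDiff_le hΔ _, abs_tentDiff_le hΔ _]
  · rw [Real.volume_real_Icc_of_le (by linarith)]
    field_simp
    ring

lemma tentCorr_eq_zero (hΔ : 0 < Δ) {s : ℝ} (h : 4 * Δ ≤ |s|) : tentCorr Δ s = 0 := by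
  unfold tentCorr
  rw [← integral_zero ℝ ℝ]
  congr 1
  ext b
  by_cases hb : b ∈ Icc (-(2 * Δ)) (2 * Δ)
  · rw [tentDiff_eq_zero hΔ (τ := b + s), mul_zero]
    have h1 := abs_le.2 hb
    have h2 := abs_sub_abs_le_abs_sub s (-b)
    rw [abs_neg, sub_neg_eq_add, add_comm s] at h2
    linarith
  · exact tentDiff_mul_eq_zero hΔ hb

lemma integrable_tentDiff_mul (hΔ : 0 < Δ) :
    Integrable (fun p : ℝ × ℝ => tentDiff Δ p.2 * tentDiff Δ (p.2 + p.1))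
      (volume.prod volume) := by
  have hc := continuous_tentDiff Δ
  refine Continuous.integrable_of_hasCompactSupport (by fun_prop) <|
    HasCompactSupport.intro ((isCompact_Icc (a := -(4 * Δ)) (b := 4 * Δ)).prod
      (isCompact_Icc (a := -(2 * Δ)) (b := 2 * Δ))) fun p hp => ?_
  by_cases hb : p.2 ∈ Icc (-(2 * Δ)) (2 * Δ)
  · rw [tentDiff_eq_zero hΔ (τ := p.2 + p.1), mul_zero]
    have h1 := abs_le.2 hb
    have h2 := abs_sub_abs_le_abs_sub p.1 (-p.2)
    rw [abs_neg, sub_neg_eq_add, add_comm p.1] at h2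
    by_contra! h3
    exact hp ⟨abs_le.1 (by linarith), hb⟩
  · exact tentDiff_mul_eq_zero hΔ hb

lemma integrable_tentCorr (hΔ : 0 < Δ) : Integrable (tentCorr Δ) :=
  (integrable_tentDiff_mul hΔ).integral_prod_left

lemma integral_tentCorr (hΔ : 0 < Δ) : ∫ s, tentCorr Δ s = 0 := by
  unfold tentCorr
  rw [integral_integral_swap (integrable_tentDiff_mul hΔ), ← integral_zero ℝ ℝ]
  congr 1
  ext b
  rw [integral_const_mul, integral_add_left_eq_self (tentDiff Δ), integral_tentDiff hΔ, mul_zero]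

/-- The kernel of the localized `L²` norm of line averages. -/
def lineKernel (Δ : ℝ) (v : ℝ × ℝ) : ℝ := ∫ a, hat (a / 8) * tentCorr Δ (v.2 - a * v.1)

lemma hat_div_eight_eq_zero {a : ℝ} (h : a ∉ Icc (-8 : ℝ) 8) : hat (a / 8) = 0 := by
  refine hat_eq_zero ?_
  rw [abs_div, abs_of_pos (by norm_num : (0 : ℝ) < 8), one_le_div (by norm_num)]
  by_contra! h'
  exact h (abs_le.1 h'.le)

lemma abs_lineKernel_le (hΔ : 0 < Δ) (v : ℝ × ℝ) : |lineKernel Δ v| ≤ 64 * Δ⁻¹ := by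
  unfold lineKernel
  rw [← setIntegral_eq_integral_of_forall_compl_eq_zero (s := Icc (-8 : ℝ) 8) fun a ha => by
    rw [hat_div_eight_eq_zero ha, zero_mul], ← Real.norm_eq_abs]
  refine (norm_setIntegral_le_of_norm_le_const (C := 1 * (4 * Δ⁻¹)) (by simp) fun a _ => ?_).trans
    (le_of_eq ?_)
  · rw [norm_mul, Real.norm_of_nonneg (hat_nonneg _)]
    gcongr
    exacts [hat_le_one _, abs_tentCorr_le hΔ _]
  · rw [Real.volume_real_Icc_of_le (by norm_num)]
    ring

lemma abs_lineKernel_le_of_ne (hΔ : 0 < Δ) {v : ℝ × ℝ} (hv : v.1 ≠ 0) :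
    |lineKernel Δ v| ≤ 16 * Δ / v.1 ^ 2 := by
  have hv' : 0 < |v.1| := abs_pos.2 hv
  let g : ℝ → ℝ := fun s => hat ((v.2 - s) / v.1 / 8) * tentCorr Δ s
  have h1 : lineKernel Δ v = |v.1|⁻¹ * ∫ s, g s := by
    have e1 : lineKernel Δ v = ∫ a, (fun y => g (v.2 - y)) (a * v.1) := by
      unfold lineKernel
      congr 1
      ext a
      simp only [g]
      rw [sub_sub_cancel, mul_div_cancel_right₀ _ hv]
    rw [e1, Measure.integral_comp_mul_right (fun y => g (v.2 - y)), integral_sub_left_eq_self g, smul_eq_mul, abs_inv]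
  have hcont : Continuous fun s => hat ((v.2 - s) / v.1 / 8) := by
    have := continuous_hat
    fun_prop
  have hgint : Integrable g := (integrable_tentCorr hΔ).bdd_mul hcont.aestronglyMeasurable
    (c := 1) (Filter.Eventually.of_forall fun s => by
      rw [Real.norm_of_nonneg (hat_nonneg _)]
      exact hat_le_one _)
  have h2 : ∫ s, g s =
      ∫ s, (hat ((v.2 - s) / v.1 / 8) - hat (v.2 / v.1 / 8)) * tentCorr Δ s := by
    have := integral_sub hgint ((integrable_tentCorr hΔ).const_mul (hat (v.2 / v.1 / 8)))
    rw [integral_const_mul, integral_tentCorr hΔ, mul_zero, sub_zero] at this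
    rw [← this]
    congr 1
    ext s
    simp only [g]
    ring
  rw [h1, h2, ← setIntegral_eq_integral_of_forall_compl_eq_zero (s := Icc (-(4 * Δ)) (4 * Δ))
    fun s hs => by
      rw [tentCorr_eq_zero hΔ, mul_zero]
      by_contra! h'
      exact hs (abs_le.1 h'.le), abs_mul, abs_of_pos (inv_pos.2 hv')]
  have h3 : |∫ s in Icc (-(4 * Δ)) (4 * Δ),
      (hat ((v.2 - s) / v.1 / 8) - hat (v.2 / v.1 / 8)) * tentCorr Δ s| ≤
      (4 * Δ / |v.1| / 8 * (4 * Δ⁻¹)) * (8 * Δ) := by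
    rw [← Real.norm_eq_abs]
    refine (norm_setIntegral_le_of_norm_le_const (C := 4 * Δ / |v.1| / 8 * (4 * Δ⁻¹)) (by simp)
      fun s hs => ?_).trans (le_of_eq ?_)
    · rw [norm_mul]
      gcongr
      · refine (abs_hat_sub_hat_le _ _).trans ?_
        rw [← sub_div, ← sub_div, abs_div, abs_div, sub_sub_cancel_left, abs_neg,
          abs_of_pos (by norm_num : (0 : ℝ) < 8)]
        gcongr
        exact abs_le.2 hs
      · exact abs_tentCorr_le hΔ _
    · rw [Real.volume_real_Icc_of_le (by linarith)]
      ring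
  calc _ ≤ |v.1|⁻¹ * ((4 * Δ / |v.1| / 8 * (4 * Δ⁻¹)) * (8 * Δ)) := by gcongr
    _ = 16 * Δ / v.1 ^ 2 := by
      rw [← sq_abs v.1]
      field_simp
      ring

lemma lineKernel_eq_zero (hΔ : 0 < Δ) {v : ℝ × ℝ} (h1 : 16 * |v.1| ≤ |v.2|) (h2 : 8 * Δ ≤ |v.2|) :
    lineKernel Δ v = 0 := by
  unfold lineKernel
  rw [← integral_zero ℝ ℝ]
  congr 1
  ext a
  by_cases ha : a ∈ Icc (-8 : ℝ) 8
  · rw [tentCorr_eq_zero hΔ, mul_zero]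
    have h3 := abs_sub_abs_le_abs_sub v.2 (a * v.1)
    rw [abs_mul] at h3
    have h4 : |a| * |v.1| ≤ 8 * |v.1| := by
      gcongr
      exact abs_le.2 ha
    linarith
  · rw [hat_div_eight_eq_zero ha, zero_mul]

lemma abs_lineKernel_le_max (hΔ : 0 < Δ) (v : ℝ × ℝ) :
    |lineKernel Δ v| ≤ 4096 * (Δ * max Δ ‖v‖ ^ (-2 : ℝ)) := by
  have hm : 0 < max Δ ‖v‖ := hΔ.trans_le (le_max_left _ _)
  rw [Real.rpow_neg hm.le, show ((2 : ℝ)) = ((2 : ℕ) : ℝ) by norm_num, Real.rpow_natCast,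
    ← div_eq_mul_inv]
  by_cases h8 : ‖v‖ ≤ 8 * Δ
  · refine (abs_lineKernel_le hΔ v).trans ?_
    have : max Δ ‖v‖ ≤ 8 * Δ := max_le (by linarith) h8
    calc 64 * Δ⁻¹ = 4096 * (Δ / (8 * Δ) ^ 2) := by
          field_simp
          norm_num
      _ ≤ _ := by gcongr
  · push Not at h8
    rw [max_eq_right (by linarith)]
    have hv0 : 0 < ‖v‖ := by linarith
    have hv : ‖v‖ = max |v.1| |v.2| := Prod.norm_def v
    by_cases h1 : ‖v‖ ≤ 16 * |v.1|
    · have h10 : 0 < |v.1| := by linarith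
      refine (abs_lineKernel_le_of_ne hΔ (abs_pos.1 h10)).trans ?_
      rw [← sq_abs v.1]
      calc 16 * Δ / |v.1| ^ 2 = 4096 * (Δ / (16 * |v.1|) ^ 2) := by
            field_simp
            norm_num
        _ ≤ _ := by gcongr
    · push Not at h1
      have h2 : ‖v‖ = |v.2| := by
        rcases max_choice |v.1| |v.2| with h | h
        · rw [hv, h] at h1
          linarith [abs_nonneg v.1]
        · rw [hv, h]
      rw [lineKernel_eq_zero hΔ (by linarith) (by linarith), abs_zero]
      positivity

end

/-- Average of `tentDiff` over the strip around the line `y = a x + b`, where `ℓ = (a, b)`. -/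
def lineAvg (Δ : ℝ) (ν : Measure (ℝ × ℝ)) (ℓ : ℝ × ℝ) : ℝ :=
  ∫ z, tentDiff Δ (ℓ.2 - z.2 + ℓ.1 * z.1) ∂ν

lemma measurable_lineAvg (Δ : ℝ) (ν : Measure (ℝ × ℝ)) [SFinite ν] : Measurable (lineAvg Δ ν) := by
  have hc := continuous_tentDiff Δ
  have : Continuous fun q : (ℝ × ℝ) × (ℝ × ℝ) => tentDiff Δ (q.1.2 - q.2.2 + q.1.1 * q.2.1) := by
    fun_prop
  exact (this.stronglyMeasurable.integral_prod_right (ν := ν)).measurable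

lemma integral_strip_mul {Δ : ℝ} (hΔ : 0 < Δ) (hΔ1 : Δ ≤ 1) {z z' : ℝ × ℝ} (hz : ‖z‖ ≤ 1) :
    ∫ ℓ in Icc (-8 : ℝ) 8 ×ˢ Icc (-11 : ℝ) 11, hat (ℓ.1 / 8) *
      (tentDiff Δ (ℓ.2 - z.2 + ℓ.1 * z.1) * tentDiff Δ (ℓ.2 - z'.2 + ℓ.1 * z'.1)) =
      lineKernel Δ (z - z') := by
  have hc := continuous_tentDiff Δ
  have hh := continuous_hat
  have hcont : Continuous fun ℓ : ℝ × ℝ => hat (ℓ.1 / 8) *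
      (tentDiff Δ (ℓ.2 - z.2 + ℓ.1 * z.1) * tentDiff Δ (ℓ.2 - z'.2 + ℓ.1 * z'.1)) := by fun_prop
  rw [Measure.volume_eq_prod, setIntegral_prod _
    (hcont.continuousOn.integrableOn_compact (isCompact_Icc.prod isCompact_Icc))]
  unfold lineKernel
  rw [← setIntegral_eq_integral_of_forall_compl_eq_zero (s := Icc (-8 : ℝ) 8)
    (f := fun a => hat (a / 8) * _) fun a ha => by rw [hat_div_eight_eq_zero ha, zero_mul]]
  refine setIntegral_congr_fun measurableSet_Icc fun a ha => ?_
  simp only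
  rw [integral_const_mul, setIntegral_eq_integral_of_forall_compl_eq_zero fun b hb => by
    rw [tentDiff_eq_zero hΔ, zero_mul]
    by_contra! h'
    have h1 : |z.1| ≤ 1 := (norm_fst_le z).trans hz
    have h2 : |z.2| ≤ 1 := (norm_snd_le z).trans hz
    have h3 : |a * z.1| ≤ 8 := by
      rw [abs_mul]
      calc |a| * |z.1| ≤ 8 * 1 := by
            gcongr
            exact abs_le.2 ha
        _ = 8 := by norm_num
    rw [abs_lt] at h'
    rw [abs_le] at h2 h3
    exact hb ⟨by linarith, by linarith⟩]
  congr 1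
  have := integral_sub_right_eq_self (μ := volume) (fun b => tentDiff Δ b *
    tentDiff Δ (b + ((z - z').2 - a * (z - z').1))) (z.2 - a * z.1)
  rw [tentCorr, ← this]
  congr 1
  ext b
  simp only [Prod.fst_sub, Prod.snd_sub]
  congr 2 <;> ring

/-- `L²` estimate for line averages of a measure of dimension larger than `1`. -/
lemma lintegral_lineAvg_sq_le {ν : Measure (ℝ × ℝ)} [IsProbabilityMeasure ν] {C t Δ : ℝ}
    (hC : 0 ≤ C) (ht : t < 2) (hν1 : ν (closedBall 0 1)ᶜ = 0)
    (hν : ∀ p r, 0 < r → ν (closedBall p r) ≤ ENNReal.ofReal (C * r ^ t))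
    (hΔ : 0 < Δ) (hΔ1 : Δ ≤ 1) :
    ∫⁻ ℓ in Icc (-4 : ℝ) 4 ×ˢ Icc (-11 : ℝ) 11, ENNReal.ofReal (lineAvg Δ ν ℓ ^ 2) ≤
      ENNReal.ofReal (2 * 4096 * (2 ^ (2 : ℝ) / (1 - 2 ^ (t - 2)) * C) * Δ ^ (t - 1)) := by
  set Q : Set (ℝ × ℝ) := Icc (-8 : ℝ) 8 ×ˢ Icc (-11 : ℝ) 11 with hQ
  have hQm : MeasurableSet Q := measurableSet_Icc.prod measurableSet_Icc
  have hc := continuous_tentDiff Δ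
  have hh := continuous_hat
  have : IsFiniteMeasure (volume.restrict Q) :=
    ⟨by
      rw [Measure.restrict_apply_univ]
      exact (isCompact_Icc.prod isCompact_Icc).measure_lt_top⟩
  let F : (ℝ × ℝ) × ((ℝ × ℝ) × (ℝ × ℝ)) → ℝ := fun q => hat (q.1.1 / 8) *
    (tentDiff Δ (q.1.2 - q.2.1.2 + q.1.1 * q.2.1.1) *
      tentDiff Δ (q.1.2 - q.2.2.2 + q.1.1 * q.2.2.1))
  have hF : Integrable F ((volume.restrict Q).prod (ν.prod ν)) := by
    have hFc : Continuous F := by fun_prop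
    refine Integrable.of_bound hFc.aestronglyMeasurable (1 * (Δ⁻¹ * Δ⁻¹))
      (Filter.Eventually.of_forall fun q => ?_)
    simp only [F, norm_mul, Real.norm_of_nonneg (hat_nonneg _)]
    gcongr
    exacts [hat_le_one _, abs_tentDiff_le hΔ _, abs_tentDiff_le hΔ _]
  have hsq : ∀ ℓ : ℝ × ℝ, ∫ q, F (ℓ, q) ∂(ν.prod ν) = hat (ℓ.1 / 8) * lineAvg Δ ν ℓ ^ 2 := by
    intro ℓ
    simp only [F]
    rw [integral_const_mul, integral_prod_mul
      (fun z : ℝ × ℝ => tentDiff Δ (ℓ.2 - z.2 + ℓ.1 * z.1))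
      (fun z : ℝ × ℝ => tentDiff Δ (ℓ.2 - z.2 + ℓ.1 * z.1)), sq]
    rfl
  have hK : ∀ᵐ q ∂(ν.prod ν), ∫ ℓ in Q, F (ℓ, q) = lineKernel Δ (q.1 - q.2) := by
    have h1 : ∀ᵐ z ∂ν, z ∈ closedBall (0 : ℝ × ℝ) 1 := hν1
    have h2 : ∀ᵐ q ∂(ν.prod ν), q.1 ∈ closedBall (0 : ℝ × ℝ) 1 :=
      Measure.quasiMeasurePreserving_fst.ae h1
    filter_upwards [h2] with q hq
    exact integral_strip_mul (z := q.1) (z' := q.2) hΔ hΔ1 (mem_closedBall_zero_iff.1 hq)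
  clear_value F
  have hmain : ∫ ℓ in Q, hat (ℓ.1 / 8) * lineAvg Δ ν ℓ ^ 2 =
      ∫ q, lineKernel Δ (q.1 - q.2) ∂(ν.prod ν) := by
    simp_rw [← hsq]
    have h1 := integral_integral_swap (f := fun ℓ q => F (ℓ, q)) hF
    have h2 := integral_congr_ae hK
    exact h1.trans h2
  have h_integrable : Integrable (fun ℓ : ℝ × ℝ => hat (ℓ.1 / 8) * lineAvg Δ ν ℓ ^ 2)
      (volume.restrict Q) := by
    simp_rw [← hsq]
    exact hF.integral_prod_left
  have hker : ENNReal.ofReal (∫ q, lineKernel Δ (q.1 - q.2) ∂(ν.prod ν)) ≤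
      ENNReal.ofReal (4096 * (2 ^ (2 : ℝ) / (1 - 2 ^ (t - 2)) * C) * Δ ^ (t - 1)) := by
    refine (ENNReal.ofReal_le_ofReal (le_abs_self _)).trans ?_
    rw [← Real.norm_eq_abs, ofReal_norm]
    refine (enorm_integral_le_lintegral_enorm _).trans ?_
    have hmeas : Measurable fun q : (ℝ × ℝ) × (ℝ × ℝ) => ENNReal.ofReal
        (max Δ (dist q.2 q.1) ^ (-2 : ℝ)) := by fun_prop
    calc ∫⁻ q, ‖lineKernel Δ (q.1 - q.2)‖ₑ ∂(ν.prod ν)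
        ≤ ∫⁻ q, ENNReal.ofReal (4096 * Δ) *
            ENNReal.ofReal (max Δ (dist q.2 q.1) ^ (-2 : ℝ)) ∂(ν.prod ν) := by
          refine lintegral_mono fun q => ?_
          rw [← ofReal_norm, Real.norm_eq_abs, ← ENNReal.ofReal_mul (by positivity)]
          refine ENNReal.ofReal_le_ofReal ((abs_lineKernel_le_max hΔ _).trans (le_of_eq ?_))
          rw [dist_comm, dist_eq_norm]
          ring
      _ = ENNReal.ofReal (4096 * Δ) * ∫⁻ z, ∫⁻ z', ENNReal.ofReal
            (max Δ (dist z' z) ^ (-2 : ℝ)) ∂ν ∂ν := by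
          rw [lintegral_const_mul _ hmeas, lintegral_prod _ hmeas.aemeasurable]
      _ ≤ ENNReal.ofReal (4096 * Δ) * ∫⁻ _, ENNReal.ofReal
            (2 ^ (2 : ℝ) / (1 - 2 ^ (t - 2)) * C * Δ ^ (t - 2)) ∂ν := by
          gcongr with z
          exact lintegral_max_rpow_neg_le hΔ hC (by norm_num) ht
            fun r hr => hν _ r (hΔ.trans_le hr)
      _ = _ := by
          rw [lintegral_const, measure_univ, mul_one, ← ENNReal.ofReal_mul (by positivity)]
          congr 1
          have : Δ ^ (t - 1) = Δ * Δ ^ (t - 2) := by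
            nth_rewrite 2 [← Real.rpow_one Δ]
            rw [← Real.rpow_add hΔ]
            ring_nf
          rw [this]
          ring
  calc ∫⁻ ℓ in Icc (-4 : ℝ) 4 ×ˢ Icc (-11 : ℝ) 11, ENNReal.ofReal (lineAvg Δ ν ℓ ^ 2)
      ≤ ∫⁻ ℓ in Icc (-4 : ℝ) 4 ×ˢ Icc (-11 : ℝ) 11,
          ENNReal.ofReal (2 * (hat (ℓ.1 / 8) * lineAvg Δ ν ℓ ^ 2)) := by
        refine setLIntegral_mono' (measurableSet_Icc.prod measurableSet_Icc) fun ℓ hℓ => ?_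
        refine ENNReal.ofReal_le_ofReal ?_
        have h1 : |ℓ.1 / 8| ≤ 1 / 2 := by
          rw [abs_div, abs_of_pos (by norm_num : (0 : ℝ) < 8), div_le_iff₀ (by norm_num)]
          have := abs_le.2 hℓ.1
          linarith
        have h2 := half_le_hat h1
        nlinarith [sq_nonneg (lineAvg Δ ν ℓ)]
    _ ≤ ∫⁻ ℓ in Q, ENNReal.ofReal (2 * (hat (ℓ.1 / 8) * lineAvg Δ ν ℓ ^ 2)) :=
        lintegral_mono_set (prod_mono (Icc_subset_Icc (by norm_num) (by norm_num)) subset_rfl)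
    _ = ENNReal.ofReal (∫ ℓ in Q, 2 * (hat (ℓ.1 / 8) * lineAvg Δ ν ℓ ^ 2)) :=
        (ofReal_integral_eq_lintegral_ofReal (h_integrable.const_mul 2)
          (Filter.Eventually.of_forall fun ℓ => by
            have := hat_nonneg (ℓ.1 / 8)
            simp only [Pi.zero_apply]
            positivity)).symm
    _ ≤ _ := by
        rw [integral_const_mul, hmain, mul_assoc 2, mul_assoc 2, ENNReal.ofReal_mul zero_le_two,
          ENNReal.ofReal_mul zero_le_two]
        gcongr

lemma volume_closedBall_prod (p : ℝ × ℝ) {r : ℝ} (hr : 0 ≤ r) :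
    volume (closedBall p r) = ENNReal.ofReal (4 * r ^ 2) := by
  rw [← Prod.mk.eta (p := p), ← closedBall_prod_same, Measure.volume_eq_prod, Measure.prod_prod,
    Real.volume_closedBall, Real.volume_closedBall, ← ENNReal.ofReal_mul (by positivity)]
  congr 1
  ring

/-- A function that is large near the support of `ρ` has large `L²` norm unless `ρ` is
concentrated. -/
lemma sq_mul_measure_sq_le {ρ : Measure (ℝ × ℝ)} [IsFiniteMeasure ρ] {h : ℝ × ℝ → ℝ}
    (hh : Measurable h) {S B : Set (ℝ × ℝ)} (hS : ρ Sᶜ = 0) (hB : MeasurableSet B) {m r : ℝ}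
    (hr : 0 < r) (hSB : ∀ ℓ ∈ S, closedBall ℓ r ⊆ B)
    (hm : ∀ ℓ ∈ S, ∀ p ∈ closedBall ℓ r, m ≤ |h p|) :
    ENNReal.ofReal m ^ 2 * ENNReal.ofReal (4 * r ^ 2) * ρ univ ^ 2 ≤
      (∫⁻ p in B, ENNReal.ofReal (h p ^ 2)) * ∫⁻ ℓ, ρ (closedBall ℓ (2 * r)) ∂ρ := by
  set V := ENNReal.ofReal (4 * r ^ 2) with hV
  have hV0 : V ≠ 0 := by simp [hV]; positivity
  have hVt : V ≠ ∞ := ENNReal.ofReal_ne_top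
  have hD : MeasurableSet {q : (ℝ × ℝ) × (ℝ × ℝ) | dist q.2 q.1 ≤ r} :=
    (isClosed_le (by fun_prop) continuous_const).measurableSet
  let I : (ℝ × ℝ) → (ℝ × ℝ) → ℝ≥0∞ := fun p ℓ =>
    {q : (ℝ × ℝ) × (ℝ × ℝ) | dist q.2 q.1 ≤ r}.indicator 1 (p, ℓ)
  have hI : Measurable (Function.uncurry I) := measurable_one.indicator hD
  have hI' : ∀ p ℓ, I p ℓ = (closedBall p r).indicator 1 ℓ := fun p ℓ => rfl
  have hI'' : ∀ p ℓ, I p ℓ = (closedBall ℓ r).indicator 1 p := fun p ℓ => by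
    rw [hI']
    simp only [indicator, mem_closedBall, dist_comm, Pi.one_apply]
  let R : (ℝ × ℝ) → ℝ≥0∞ := fun p => ρ (closedBall p r)
  have hR : ∀ p, R p = ∫⁻ ℓ, I p ℓ ∂ρ := fun p => by
    simp only [hI']
    rw [lintegral_indicator_one isClosed_closedBall.measurableSet]
  have hRm : Measurable R := by
    have : R = fun p => ∫⁻ ℓ, I p ℓ ∂ρ := funext hR
    rw [this]
    exact hI.lintegral_prod_right'
  have hvol : ∀ ℓ, ∫⁻ p, I p ℓ = V := fun ℓ => by
    simp only [hI'']
    rw [lintegral_indicator_one isClosed_closedBall.measurableSet, volume_closedBall_prod _ hr.le]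
  have hR1 : ∫⁻ p, R p = V * ρ univ := by
    simp only [hR]
    rw [lintegral_lintegral_swap hI.aemeasurable]
    simp only [hvol]
    rw [lintegral_const]
  have hE : Measurable fun ℓ => ρ (closedBall ℓ (2 * r)) := by
    have hD2 : MeasurableSet {q : (ℝ × ℝ) × (ℝ × ℝ) | dist q.2 q.1 ≤ 2 * r} :=
      (isClosed_le (by fun_prop) continuous_const).measurableSet
    exact measurable_measure_prodMk_left (ν := ρ) hD2
  have hR2 : ∫⁻ p, R p ^ 2 ≤ V * ∫⁻ ℓ, ρ (closedBall ℓ (2 * r)) ∂ρ := by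
    calc ∫⁻ p, R p ^ 2 ≤ ∫⁻ p, ∫⁻ ℓ, I p ℓ * ρ (closedBall ℓ (2 * r)) ∂ρ := by
          refine lintegral_mono fun p => ?_
          simp only
          rw [sq]
          nth_rewrite 1 [hR p]
          rw [← lintegral_mul_const _ (hI.of_uncurry_left)]
          refine lintegral_mono fun ℓ => ?_
          simp only [hI', indicator]
          split_ifs with hℓ
          · gcongr
            refine measure_mono fun x hx => ?_
            rw [mem_closedBall] at hx hℓ ⊢
            linarith [dist_triangle_right x ℓ p]
          · simp
      _ = ∫⁻ ℓ, ∫⁻ p, I p ℓ * ρ (closedBall ℓ (2 * r)) ∂volume ∂ρ := by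
          rw [lintegral_lintegral_swap]
          exact (hI.mul (hE.comp measurable_snd)).aemeasurable
      _ = V * ∫⁻ ℓ, ρ (closedBall ℓ (2 * r)) ∂ρ := by
          rw [← lintegral_const_mul _ hE]
          refine lintegral_congr fun ℓ => ?_
          rw [lintegral_mul_const _ hI.of_uncurry_right, hvol]
  let g : ℝ × ℝ → ℝ≥0∞ := B.indicator fun p => ENNReal.ofReal |h p|
  have hg : Measurable g := (hh.abs.ennreal_ofReal).indicator hB
  have hg2 : ∫⁻ p, g p ^ 2 = ∫⁻ p in B, ENNReal.ofReal (h p ^ 2) := by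
    rw [← lintegral_indicator hB]
    refine lintegral_congr fun p => ?_
    simp only [g, indicator]
    split_ifs
    · rw [← ENNReal.ofReal_pow (abs_nonneg _), sq_abs]
    · simp
  have hpt : ∀ p, ENNReal.ofReal m * R p ≤ g p * R p := by
    intro p
    by_cases hp : R p = 0
    · simp [hp]
    · have : ∃ ℓ ∈ S, ℓ ∈ closedBall p r := by
        by_contra! hcon
        exact hp (measure_mono_null (fun ℓ hℓ hℓS => hcon ℓ hℓS hℓ) hS)
      obtain ⟨ℓ, hℓS, hℓ⟩ := this
      have hp' : p ∈ closedBall ℓ r := mem_closedBall_comm.1 hℓ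
      have : g p = ENNReal.ofReal |h p| := indicator_of_mem (hSB ℓ hℓS hp') _
      rw [this]
      gcongr
      exact hm ℓ hℓS p hp'
  have hCS : (∫⁻ p, g p * R p) ^ 2 ≤ (∫⁻ p, g p ^ 2) * ∫⁻ p, R p ^ 2 := by
    have := ENNReal.lintegral_mul_le_Lp_mul_Lq volume Real.HolderConjugate.two_two
      hg.aemeasurable hRm.aemeasurable
    simp only [Pi.mul_apply, ENNReal.rpow_two] at this
    calc (∫⁻ p, g p * R p) ^ 2 ≤ ((∫⁻ p, g p ^ 2) ^ (1 / 2 : ℝ) * (∫⁻ p, R p ^ 2) ^ (1 / 2 : ℝ)) ^ 2 := by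
          gcongr
      _ = _ := by
          rw [mul_pow, ← ENNReal.rpow_two, ← ENNReal.rpow_two, ← ENNReal.rpow_mul,
            ← ENNReal.rpow_mul]
          norm_num
  have h1 : ENNReal.ofReal m * (V * ρ univ) ≤ ∫⁻ p, g p * R p := by
    rw [← hR1, ← lintegral_const_mul _ hRm]
    exact lintegral_mono hpt
  refine (ENNReal.mul_le_mul_iff_right hV0 hVt).1 ?_
  calc V * (ENNReal.ofReal m ^ 2 * V * ρ univ ^ 2) = (ENNReal.ofReal m * (V * ρ univ)) ^ 2 := by
        ring
    _ ≤ (∫⁻ p, g p * R p) ^ 2 := by gcongr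
    _ ≤ (∫⁻ p, g p ^ 2) * ∫⁻ p, R p ^ 2 := hCS
    _ ≤ (∫⁻ p in B, ENNReal.ofReal (h p ^ 2)) * (V * ∫⁻ ℓ, ρ (closedBall ℓ (2 * r)) ∂ρ) := by
        rw [hg2]
        gcongr
    _ = _ := by ring

/-- Slope of the line through `x` and `y`. -/
def slopeFrom (x y : ℝ × ℝ) : ℝ := (y.2 - x.2) / (y.1 - x.1)

/-- Slope and intercept of the line through `x` with slope `a`. -/
def lineAt (x : ℝ × ℝ) (a : ℝ) : ℝ × ℝ := (a, x.2 - a * x.1)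

/-- Average of `tent` over the strip around the line `y = a x + b`, where `ℓ = (a, b)`. -/
def tentAvg (Δ : ℝ) (ν : Measure (ℝ × ℝ)) (ℓ : ℝ × ℝ) : ℝ :=
  ∫ z, tent Δ (ℓ.2 - z.2 + ℓ.1 * z.1) ∂ν

/-- `K` lies in a bounded region seen from `x` in directions away from vertical. -/
def SeenFrom (x : ℝ × ℝ) (K : Set (ℝ × ℝ)) : Prop :=
  ‖x‖ ≤ 1 ∧ ∀ z ∈ K, ‖z‖ ≤ 1 ∧ 1 / 4 ≤ |z.1 - x.1| ∧ |z.1 - x.1| ≤ 1 ∧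
    |z.2 - x.2| ≤ 2 * |z.1 - x.1|

lemma measurable_slopeFrom (x : ℝ × ℝ) : Measurable (slopeFrom x) := by
  unfold slopeFrom
  fun_prop

lemma continuous_lineAt (x : ℝ × ℝ) : Continuous (lineAt x) := by
  unfold lineAt
  fun_prop

lemma lineAt_residual {x z : ℝ × ℝ} (h : z.1 - x.1 ≠ 0) (a : ℝ) :
    (lineAt x a).2 - z.2 + (lineAt x a).1 * z.1 = (a - slopeFrom x z) * (z.1 - x.1) := by
  unfold lineAt slopeFrom
  field_simp
  ring

lemma SeenFrom.ne_zero {x z : ℝ × ℝ} {K : Set (ℝ × ℝ)} (h : SeenFrom x K) (hz : z ∈ K) :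
    z.1 - x.1 ≠ 0 := by
  have := (h.2 z hz).2.1
  exact abs_pos.1 (by linarith)

lemma SeenFrom.abs_slopeFrom_le {x z : ℝ × ℝ} {K : Set (ℝ × ℝ)} (h : SeenFrom x K) (hz : z ∈ K) :
    |slopeFrom x z| ≤ 2 := by
  have h1 := (h.2 z hz).2
  unfold slopeFrom
  rw [abs_div, div_le_iff₀ (by linarith)]
  exact h1.2.2

lemma SeenFrom.continuousOn {x : ℝ × ℝ} {K : Set (ℝ × ℝ)} (h : SeenFrom x K) :
    ContinuousOn (slopeFrom x) K := by
  unfold slopeFrom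
  exact ContinuousOn.div (by fun_prop) (by fun_prop) fun z hz => h.ne_zero hz

section

variable {ν : Measure (ℝ × ℝ)} [IsProbabilityMeasure ν] {Δ : ℝ}

lemma integrable_tent_line (hΔ : 0 < Δ) (ℓ : ℝ × ℝ) :
    Integrable (fun z : ℝ × ℝ => tent Δ (ℓ.2 - z.2 + ℓ.1 * z.1)) ν := by
  have hc := continuous_tent Δ
  have h : Continuous fun z : ℝ × ℝ => tent Δ (ℓ.2 - z.2 + ℓ.1 * z.1) := by fun_prop
  refine Integrable.of_bound h.aestronglyMeasurable Δ⁻¹ (Filter.Eventually.of_forall fun z => ?_)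
  rw [Real.norm_of_nonneg (tent_nonneg hΔ _)]
  exact tent_le hΔ _

lemma lineAvg_eq_sub (hΔ : 0 < Δ) (ℓ : ℝ × ℝ) :
    lineAvg Δ ν ℓ = tentAvg Δ ν ℓ - tentAvg (2 * Δ) ν ℓ :=
  integral_sub (integrable_tent_line hΔ ℓ) (integrable_tent_line (by positivity) ℓ)

lemma tentAvg_le (hΔ : 0 < Δ) (ℓ : ℝ × ℝ) : tentAvg Δ ν ℓ ≤ Δ⁻¹ := by
  have := integral_mono (integrable_tent_line (ν := ν) hΔ ℓ) (integrable_const Δ⁻¹)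
    fun z => tent_le hΔ _
  simpa [tentAvg] using this

lemma measurable_tentAvg (Δ : ℝ) : Measurable (tentAvg Δ ν) := by
  have hc := continuous_tent Δ
  have : Continuous fun q : (ℝ × ℝ) × (ℝ × ℝ) => tent Δ (q.1.2 - q.2.2 + q.1.1 * q.2.1) := by
    fun_prop
  exact (this.stronglyMeasurable.integral_prod_right (ν := ν)).measurable

lemma measure_slope_near_le_tentAvg (hΔ : 0 < Δ) {x : ℝ × ℝ} {K : Set (ℝ × ℝ)}
    (h : SeenFrom x K) (a : ℝ) :
    ν {z | z ∈ K ∧ |slopeFrom x z - a| ≤ Δ / 2} ≤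
      ENNReal.ofReal (2 * Δ * tentAvg Δ ν (lineAt x a)) := by
  have h1 := mul_meas_ge_le_integral_of_nonneg (μ := ν)
    (Filter.Eventually.of_forall fun z => tent_nonneg hΔ _)
    (integrable_tent_line hΔ (lineAt x a)) (Δ⁻¹ / 2)
  have hsub : {z | z ∈ K ∧ |slopeFrom x z - a| ≤ Δ / 2} ⊆
      {z | Δ⁻¹ / 2 ≤ tent Δ ((lineAt x a).2 - z.2 + (lineAt x a).1 * z.1)} := by
    rintro z ⟨hz, hza⟩
    refine le_tent hΔ ?_
    rw [lineAt_residual (h.ne_zero hz), abs_mul, abs_sub_comm]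
    exact (mul_le_of_le_one_right (abs_nonneg _) (h.2 z hz).2.2.1).trans hza
  rw [← ofReal_measureReal]
  refine ENNReal.ofReal_le_ofReal ?_
  refine (measureReal_mono hsub).trans ?_
  have e : ∀ y : ℝ, y = 2 * Δ * (Δ⁻¹ / 2 * y) := fun y => by field_simp
  rw [e (ν.real _)]
  unfold tentAvg
  gcongr

/-- Upper bounds for strip averages at coarse scales control the mass of slope intervals. -/
lemma measure_slope_near_le {x : ℝ × ℝ} {K : Set (ℝ × ℝ)} (h : SeenFrom x K) {a u M : ℝ}
    (hu0 : 0 < u) (hu1 : u < 1) (hM : 1 ≤ M) {j : ℕ}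
    (hj : ∀ i < j, tentAvg ((1 / 2) ^ i) ν (lineAt x a) < M * ((1 / 2) ^ i) ^ (u - 1)) {r : ℝ}
    (hr : (1 / 2) ^ j ≤ r) :
    ν {z | z ∈ K ∧ |slopeFrom x z - a| ≤ r} ≤ ENNReal.ofReal (8 * M * r ^ u) := by
  have hr0 : 0 < r := lt_of_lt_of_le (by positivity) hr
  by_cases hr2 : 1 / 2 < r
  · refine prob_le_one.trans ?_
    rw [← ENNReal.ofReal_one]
    refine ENNReal.ofReal_le_ofReal ?_
    have h1 : (1 / 2 : ℝ) ≤ r ^ u := by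
      calc (1 / 2 : ℝ) = (1 / 2) ^ (1 : ℝ) := (Real.rpow_one _).symm
        _ ≤ (1 / 2) ^ u := Real.rpow_le_rpow_of_exponent_ge (by norm_num) (by norm_num) hu1.le
        _ ≤ r ^ u := by gcongr
    nlinarith
  · push Not at hr2
    obtain ⟨i, hi1, hi2⟩ := exists_nat_pow_near_of_lt_one (x := 2 * r) (y := (1 / 2 : ℝ))
      (by linarith) (by linarith) (by norm_num) (by norm_num)
    have hij : i < j := by
      by_contra! hij
      have h1 : (1 / 2 : ℝ) ^ i ≤ (1 / 2) ^ j :=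
        pow_le_pow_of_le_one (by norm_num) (by norm_num) hij
      linarith
    have hpos : (0 : ℝ) < (1 / 2) ^ i := by positivity
    refine (measure_mono (t := {z | z ∈ K ∧ |slopeFrom x z - a| ≤ (1 / 2) ^ i / 2})
      fun z hz => ⟨hz.1, hz.2.trans (by linarith)⟩).trans
      ((measure_slope_near_le_tentAvg hpos h a).trans ?_)
    · refine ENNReal.ofReal_le_ofReal ?_
      have h1 : ((1 / 2 : ℝ) ^ i) ^ u ≤ 4 * r ^ u := by
        rw [pow_succ] at hi1
        calc ((1 / 2 : ℝ) ^ i) ^ u ≤ (4 * r) ^ u := by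
              gcongr
              linarith
          _ = 4 ^ u * r ^ u := Real.mul_rpow (by norm_num) hr0.le
          _ ≤ 4 ^ (1 : ℝ) * r ^ u := by
              gcongr
              norm_num
          _ = 4 * r ^ u := by rw [Real.rpow_one]
      have h2 : (1 / 2 : ℝ) ^ i * ((1 / 2) ^ i) ^ (u - 1) = ((1 / 2) ^ i) ^ u := by
        rw [Real.rpow_sub_one hpos.ne']
        field_simp
      calc 2 * (1 / 2 : ℝ) ^ i * tentAvg ((1 / 2) ^ i) ν (lineAt x a)
          ≤ 2 * (1 / 2 : ℝ) ^ i * (M * ((1 / 2) ^ i) ^ (u - 1)) := by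
            gcongr
            exact (hj i hij).le
        _ = 2 * M * ((1 / 2) ^ i) ^ u := by rw [← h2]; ring
        _ ≤ 2 * M * (4 * r ^ u) := by gcongr
        _ = _ := by ring

variable (ν) in
/-- Points of `K` for which `(1 / 2) ^ j` is the first scale with a heavy strip towards `x`. -/
def heavyAt (K : Set (ℝ × ℝ)) (u M : ℝ) (x : ℝ × ℝ) (j : ℕ) : Set (ℝ × ℝ) :=
  {y | y ∈ K ∧ M * ((1 / 2) ^ j) ^ (u - 1) ≤ tentAvg ((1 / 2) ^ j) ν (lineAt x (slopeFrom x y)) ∧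
    ∀ i < j, tentAvg ((1 / 2) ^ i) ν (lineAt x (slopeFrom x y)) < M * ((1 / 2) ^ i) ^ (u - 1)}

lemma measurableSet_heavyAt {K : Set (ℝ × ℝ)} (hK : MeasurableSet K) (u M : ℝ) (x : ℝ × ℝ)
    (j : ℕ) : MeasurableSet (heavyAt ν K u M x j) := by
  have hm : ∀ i : ℕ, Measurable fun y => tentAvg ((1 / 2) ^ i) ν (lineAt x (slopeFrom x y)) :=
    fun i => (measurable_tentAvg _).comp ((continuous_lineAt x).measurable.comp
      (measurable_slopeFrom x))
  have h : MeasurableSet {y | ∀ i < j, tentAvg ((1 / 2) ^ i) ν (lineAt x (slopeFrom x y)) <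
      M * ((1 / 2) ^ i) ^ (u - 1)} := by
    simp only [ofPred_forall]
    exact MeasurableSet.iInter fun i => MeasurableSet.iInter fun _ =>
      measurableSet_lt (hm i) measurable_const
  exact hK.inter ((measurableSet_le measurable_const (hm j)).inter h)

/-- If the slopes form a null set, almost every point has a heavy strip at some scale. -/
lemma measure_iUnion_heavyAt {x : ℝ × ℝ} {K : Set (ℝ × ℝ)} (hK : IsCompact K) (hνK : ν Kᶜ = 0)
    (h : SeenFrom x K) {u M : ℝ} (hu0 : 0 < u) (hu1 : u < 1) (hM : 1 ≤ M)
    (hnull : μH[u] (slopeFrom x '' K) = 0) : 1 ≤ ν (⋃ j, heavyAt ν K u M x j) := by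
  classical
  set N : Set (ℝ × ℝ) := {y | y ∈ K ∧
    ∀ i, tentAvg ((1 / 2) ^ i) ν (lineAt x (slopeFrom x y)) < M * ((1 / 2) ^ i) ^ (u - 1)} with hN
  have hcover : univ ⊆ (⋃ j, heavyAt ν K u M x j) ∪ (N ∪ Kᶜ) := by
    intro y _
    by_cases hy : y ∈ K
    · by_cases hex : ∃ i, M * ((1 / 2) ^ i) ^ (u - 1) ≤
          tentAvg ((1 / 2) ^ i) ν (lineAt x (slopeFrom x y))
      · refine Or.inl (mem_iUnion.2 ⟨Nat.find hex, hy, Nat.find_spec hex, fun i hi => ?_⟩)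
        exact not_le.1 (Nat.find_min hex hi)
      · push Not at hex
        exact Or.inr (Or.inl ⟨hy, hex⟩)
    · exact Or.inr (Or.inr hy)
  have hball : ∀ y ∈ N, ∀ r : ℝ, 0 < r →
      ν {z | z ∈ K ∧ |slopeFrom x z - slopeFrom x y| ≤ r} ≤ ENNReal.ofReal (8 * M * r ^ u) := by
    intro y hy r hr
    obtain ⟨j, hj⟩ := exists_pow_lt_of_lt_one hr (by norm_num : (1 / 2 : ℝ) < 1)
    exact measure_slope_near_le h hu0 hu1 hM (j := j) (fun i _ => hy.2 i) hj.le
  have hN0 : ν N = 0 := by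
    have hσ := measurable_slopeFrom x
    set μ : Measure ℝ := (ENNReal.ofReal (8 * M))⁻¹ • (ν.restrict N).map (slopeFrom x) with hμ
    have h8 : ENNReal.ofReal (8 * M) ≠ 0 := by simp; linarith
    have hle : μ ≤ μH[u] := by
      refine Measure.le_hausdorffMeasure u μ 1 one_pos fun s hs => ?_
      have hst : ediam (closure s) ≠ ∞ := by
        rw [ediam_closure]
        exact ne_top_of_le_ne_top ENNReal.one_ne_top hs
      have hbound : ∀ r : ℝ, 0 < r → ediam (closure s) ≤ ENNReal.ofReal r →
          μ s ≤ ENNReal.ofReal r ^ u := by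
        intro r hr hd
        calc μ s ≤ μ (closure s) := measure_mono subset_closure
          _ = (ENNReal.ofReal (8 * M))⁻¹ * ν (slopeFrom x ⁻¹' closure s ∩ N) := by
              rw [hμ, Measure.smul_apply, smul_eq_mul,
                Measure.map_apply hσ isClosed_closure.measurableSet,
                Measure.restrict_apply (hσ isClosed_closure.measurableSet)]
          _ ≤ (ENNReal.ofReal (8 * M))⁻¹ * ENNReal.ofReal (8 * M * r ^ u) := by
              gcongr
              rcases (slopeFrom x ⁻¹' closure s ∩ N).eq_empty_or_nonempty with he | ⟨y, hy, hyN⟩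
              · rw [he]
                simp
              · refine (measure_mono (t := {z | z ∈ K ∧ |slopeFrom x z - slopeFrom x y| ≤ r})
                  fun z hz => ⟨hz.2.1, ?_⟩).trans (hball y hyN r hr)
                have hz1 : slopeFrom x z ∈ closure s := hz.1
                have hy1 : slopeFrom x y ∈ closure s := hy
                have := (edist_le_ediam_of_mem hz1 hy1).trans hd
                rwa [edist_dist, ENNReal.ofReal_le_ofReal_iff hr.le, Real.dist_eq] at this
          _ = ENNReal.ofReal r ^ u := by
              rw [ENNReal.ofReal_mul (by linarith : 0 ≤ 8 * M), ← mul_assoc,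
                ENNReal.inv_mul_cancel h8 ENNReal.ofReal_ne_top, one_mul,
                ENNReal.ofReal_rpow_of_pos hr]
      have hlim : Filter.Tendsto (fun r : ℝ => ENNReal.ofReal ((ediam (closure s)).toReal + r) ^ u)
          (nhdsWithin 0 (Ioi 0)) (nhds (ediam (closure s) ^ u)) := by
        have h1 : Continuous fun r : ℝ => ENNReal.ofReal ((ediam (closure s)).toReal + r) ^ u :=
          ENNReal.continuous_rpow_const.comp (ENNReal.continuous_ofReal.comp (by fun_prop))
        have h2 := (h1.tendsto 0).mono_left (nhdsWithin_le_nhds (s := Ioi (0 : ℝ)))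
        rwa [add_zero, ENNReal.ofReal_toReal hst] at h2
      rw [← ediam_closure]
      refine ge_of_tendsto hlim ?_
      filter_upwards [self_mem_nhdsWithin] with r hr
      have hr : 0 < r := hr
      refine hbound _ (by positivity) ?_
      rw [← ENNReal.ofReal_toReal hst]
      exact ENNReal.ofReal_le_ofReal (by simp [hr.le])
    have h0 : μ (slopeFrom x '' K) = 0 := le_antisymm ((hle _).trans hnull.le) bot_le
    have hm : MeasurableSet (slopeFrom x '' K) :=
      (hK.image_of_continuousOn h.continuousOn).measurableSet
    rw [hμ, Measure.smul_apply, smul_eq_mul, mul_eq_zero, ENNReal.inv_eq_zero,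
      Measure.map_apply hσ hm, Measure.restrict_apply (hσ hm)] at h0
    have h0 := h0.resolve_left ENNReal.ofReal_ne_top
    exact measure_mono_null (t := slopeFrom x ⁻¹' (slopeFrom x '' K) ∩ N)
      (fun y hy => ⟨mem_image_of_mem _ hy.1, hy⟩) h0
  calc 1 = ν univ := measure_univ.symm
    _ ≤ ν ((⋃ j, heavyAt ν K u M x j) ∪ (N ∪ Kᶜ)) := measure_mono hcover
    _ ≤ ν (⋃ j, heavyAt ν K u M x j) + (ν N + ν Kᶜ) :=
        (measure_union_le _ _).trans (by gcongr; exact measure_union_le _ _)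
    _ = ν (⋃ j, heavyAt ν K u M x j) := by rw [hN0, hνK, add_zero, add_zero]

end

section

variable {ν : Measure (ℝ × ℝ)} [IsProbabilityMeasure ν]

lemma le_lineAvg_of_mem_heavyAt {x y : ℝ × ℝ} {K : Set (ℝ × ℝ)} {u M : ℝ} {j : ℕ} (hj : 0 < j)
    (hy : y ∈ heavyAt ν K u M x j) :
    (1 - 2 ^ (u - 1)) * (M * ((1 / 2) ^ j) ^ (u - 1)) ≤
      lineAvg ((1 / 2) ^ j) ν (lineAt x (slopeFrom x y)) := by
  rw [lineAvg_eq_sub (by positivity)]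
  have h1 := hy.2.1
  have h2 := (hy.2.2 (j - 1) (by omega)).le
  obtain ⟨i, rfl⟩ : ∃ i, j = i + 1 := ⟨j - 1, by omega⟩
  have e : (1 / 2 : ℝ) ^ i = 2 * (1 / 2) ^ (i + 1) := by rw [pow_succ]; ring
  rw [Nat.add_sub_cancel, e, Real.mul_rpow (by norm_num) (by positivity)] at h2
  linarith

lemma abs_lineAvg_sub_le {x : ℝ × ℝ} {K : Set (ℝ × ℝ)} (h : SeenFrom x K)
    (hK : MeasurableSet K) (hνK : ν Kᶜ = 0) {Δ r a : ℝ} (hΔ : 0 < Δ) (hr : r ≤ Δ / 4)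
    {ℓ : ℝ × ℝ} (hℓ : ℓ ∈ closedBall (lineAt x a) r) :
    |lineAvg Δ ν ℓ - lineAvg Δ ν (lineAt x a)| ≤
      4 * r * Δ⁻¹ ^ 2 * ν.real {z | z ∈ K ∧ |slopeFrom x z - a| ≤ 16 * Δ} := by
  set T : Set (ℝ × ℝ) := {z | z ∈ K ∧ |slopeFrom x z - a| ≤ 16 * Δ} with hT
  have hr0 : 0 ≤ r := dist_nonneg.trans (mem_closedBall.1 hℓ)
  have hTm : MeasurableSet T := by
    have := measurable_slopeFrom x
    have hm : Measurable fun z => |slopeFrom x z - a| := by fun_prop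
    exact hK.inter (measurableSet_le hm measurable_const)
  have h_integrable : ∀ ℓ : ℝ × ℝ, Integrable
      (fun z : ℝ × ℝ => tentDiff Δ (ℓ.2 - z.2 + ℓ.1 * z.1)) ν := fun ℓ =>
    (integrable_tent_line hΔ ℓ).sub (integrable_tent_line (by positivity) ℓ)
  unfold lineAvg
  rw [← integral_sub (h_integrable _) (h_integrable _), ← Real.norm_eq_abs]
  have hc : 4 * r * Δ⁻¹ ^ 2 * ν.real T = ∫ z, T.indicator (fun _ => 4 * r * Δ⁻¹ ^ 2) z ∂ν := by
    rw [integral_indicator_const _ hTm, smul_eq_mul, mul_comm]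
  rw [hc]
  refine norm_integral_le_of_norm_le ((integrable_const _).indicator hTm) ?_
  have hKae : ∀ᵐ z ∂ν, z ∈ K := by
    rw [ae_iff]
    exact hνK
  filter_upwards [hKae] with z hz
  have hd := mem_closedBall.1 hℓ
  rw [Prod.dist_eq, max_le_iff, Real.dist_eq, Real.dist_eq] at hd
  have hz1 : |z.1| ≤ 1 := (norm_fst_le z).trans (h.2 z hz).1
  have hdiff : |(ℓ.2 - z.2 + ℓ.1 * z.1) -
      ((lineAt x a).2 - z.2 + (lineAt x a).1 * z.1)| ≤ 2 * r := by
    have e : (ℓ.2 - z.2 + ℓ.1 * z.1) - ((lineAt x a).2 - z.2 + (lineAt x a).1 * z.1) =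
        (ℓ.2 - (lineAt x a).2) + (ℓ.1 - (lineAt x a).1) * z.1 := by ring
    rw [e]
    refine (abs_add_le _ _).trans ?_
    rw [abs_mul]
    have : |ℓ.1 - (lineAt x a).1| * |z.1| ≤ r * 1 := by gcongr; exact hd.1
    linarith [hd.2]
  rw [Real.norm_eq_abs]
  by_cases hzT : z ∈ T
  · rw [indicator_of_mem hzT]
    refine (abs_tentDiff_sub_le hΔ _ _).trans ?_
    have : 0 ≤ 2 * Δ⁻¹ ^ 2 := by positivity
    nlinarith
  · rw [indicator_of_notMem hzT]
    have hfar : 16 * Δ < |slopeFrom x z - a| := by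
      by_contra! hh
      exact hzT ⟨hz, hh⟩
    have hτ : 4 * Δ ≤ |(lineAt x a).2 - z.2 + (lineAt x a).1 * z.1| := by
      rw [lineAt_residual (h.ne_zero hz), abs_mul, abs_sub_comm]
      have := (h.2 z hz).2.1
      nlinarith
    rw [tentDiff_eq_zero hΔ (by linarith : 2 * Δ ≤ |(lineAt x a).2 - z.2 + (lineAt x a).1 * z.1|),
      tentDiff_eq_zero hΔ, sub_zero, abs_zero]
    rw [abs_sub_comm] at hdiff
    have := abs_sub_abs_le_abs_sub ((lineAt x a).2 - z.2 + (lineAt x a).1 * z.1)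
      (ℓ.2 - z.2 + ℓ.1 * z.1)
    linarith

/-- Near the line of a heavy point, the averages stay large. -/
lemma le_abs_lineAvg_of_mem_heavyAt {x y : ℝ × ℝ} {K : Set (ℝ × ℝ)} (h : SeenFrom x K)
    (hK : MeasurableSet K) (hνK : ν Kᶜ = 0) {u M κ : ℝ} (hu0 : 0 < u) (hu1 : u < 1) (hM : 1 ≤ M)
    (hκ : κ = 1 - 2 ^ (u - 1)) {j : ℕ} (hj : 0 < j)
    (hy : y ∈ heavyAt ν K u M x j) {ℓ : ℝ × ℝ}
    (hℓ : ℓ ∈ closedBall (lineAt x (slopeFrom x y)) (κ / 1024 * (1 / 2) ^ j)) :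
    κ / 2 * (M * ((1 / 2) ^ j) ^ (u - 1)) ≤ |lineAvg ((1 / 2) ^ j) ν ℓ| := by
  have h1 := le_lineAvg_of_mem_heavyAt hj hy
  rw [← hκ] at h1
  set Δ : ℝ := (1 / 2) ^ j with hΔ
  have hΔ0 : 0 < Δ := by positivity
  have hκ0 : 0 < κ := by
    rw [hκ, sub_pos]
    exact Real.rpow_lt_one_of_one_lt_of_neg (by norm_num) (by linarith)
  have hκ1 : κ ≤ 1 := by
    have : (0 : ℝ) < 2 ^ (u - 1) := by positivity
    linarith
  have h2 := abs_lineAvg_sub_le h hK hνK hΔ0 (by nlinarith) hℓ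
  have h3 : ν.real {z | z ∈ K ∧ |slopeFrom x z - slopeFrom x y| ≤ 16 * Δ} ≤ 128 * M * Δ ^ u := by
    refine ENNReal.toReal_le_of_le_ofReal (by positivity) ?_
    refine (measure_slope_near_le h hu0 hu1 hM hy.2.2 (by linarith : Δ ≤ 16 * Δ)).trans ?_
    refine ENNReal.ofReal_le_ofReal ?_
    rw [Real.mul_rpow (by norm_num) hΔ0.le]
    have : (16 : ℝ) ^ u ≤ 16 := by
      calc (16 : ℝ) ^ u ≤ 16 ^ (1 : ℝ) := by
            gcongr
            norm_num
        _ = 16 := Real.rpow_one _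
    calc 8 * M * (16 ^ u * Δ ^ u) ≤ 8 * M * (16 * Δ ^ u) := by gcongr
      _ = _ := by ring
  have h4 : 4 * (κ / 1024 * Δ) * Δ⁻¹ ^ 2 *
      ν.real {z | z ∈ K ∧ |slopeFrom x z - slopeFrom x y| ≤ 16 * Δ} ≤
      κ / 2 * (M * Δ ^ (u - 1)) := by
    calc 4 * (κ / 1024 * Δ) * Δ⁻¹ ^ 2 *
          ν.real {z | z ∈ K ∧ |slopeFrom x z - slopeFrom x y| ≤ 16 * Δ}
        ≤ 4 * (κ / 1024 * Δ) * Δ⁻¹ ^ 2 * (128 * M * Δ ^ u) := by gcongr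
      _ = _ := by
          rw [Real.rpow_sub_one hΔ0.ne']
          field_simp
          norm_num
  have h5 := (abs_le.1 (h2.trans h4)).1
  exact le_trans (by linarith) (le_abs_self _)

/-- For two centres `x, x'`, the mass of pairs of heavy points on almost the same line. -/
lemma lintegral_heavyAt_le {x x' : ℝ × ℝ} {K : Set (ℝ × ℝ)} (h : SeenFrom x K)
    (h' : SeenFrom x' K) (hK : MeasurableSet K)
    {u M : ℝ} (hu0 : 0 < u) (hu1 : u < 1) (hM : 1 ≤ M) {j : ℕ} {r : ℝ}
    (hr : r ≤ (1 / 2) ^ j / 4) :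
    ∫⁻ y in heavyAt ν K u M x j, ν (heavyAt ν K u M x' j ∩
      (fun y' => lineAt x' (slopeFrom x' y')) ⁻¹' closedBall (lineAt x (slopeFrom x y)) r) ∂ν ≤
      ENNReal.ofReal (384 * M ^ 2 * ((1 / 2) ^ j) ^ (2 * u) *
        max ((1 / 2) ^ j) (dist x' x) ^ (-u)) := by
  have hDm : MeasurableSet (heavyAt ν K u M x j) := measurableSet_heavyAt hK u M x j
  set Δ : ℝ := (1 / 2) ^ j with hΔ
  have hΔ0 : 0 < Δ := by positivity
  set D := heavyAt ν K u M x j with hD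
  set S : Set (ℝ × ℝ) := {y | |x'.2 - x.2 - slopeFrom x y * (x'.1 - x.1)| ≤ Δ} with hS
  have hSm : MeasurableSet S := by
    have := measurable_slopeFrom x
    exact measurableSet_le (by fun_prop) measurable_const
  have hpoint : ∀ y ∈ D, ν (heavyAt ν K u M x' j ∩ (fun y' => lineAt x' (slopeFrom x' y')) ⁻¹'
      closedBall (lineAt x (slopeFrom x y)) r) ≤
      S.indicator (fun _ => ENNReal.ofReal (8 * M * Δ ^ u)) y := by
    intro y hy
    rcases (heavyAt ν K u M x' j ∩ (fun y' => lineAt x' (slopeFrom x' y')) ⁻¹'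
      closedBall (lineAt x (slopeFrom x y)) r).eq_empty_or_nonempty with he | ⟨y₀, hy₀, hy₀r⟩
    · rw [he, measure_empty]
      exact zero_le
    · have hd := mem_closedBall.1 (mem_preimage.1 hy₀r)
      rw [Prod.dist_eq, max_le_iff, Real.dist_eq, Real.dist_eq] at hd
      simp only [lineAt] at hd
      have hx1 : |x'.1| ≤ 1 := (norm_fst_le x').trans h'.1
      have hyS : y ∈ S := by
        have e : x'.2 - x.2 - slopeFrom x y * (x'.1 - x.1) =
            (x'.2 - slopeFrom x' y₀ * x'.1 - (x.2 - slopeFrom x y * x.1)) +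
              (slopeFrom x' y₀ - slopeFrom x y) * x'.1 := by ring
        change |x'.2 - x.2 - slopeFrom x y * (x'.1 - x.1)| ≤ Δ
        rw [e]
        refine (abs_add_le _ _).trans ?_
        rw [abs_mul]
        have : |slopeFrom x' y₀ - slopeFrom x y| * |x'.1| ≤ r * 1 := by
          gcongr
          · exact (abs_nonneg _).trans hd.1
          · exact hd.1
        linarith [hd.2]
      rw [indicator_of_mem hyS]
      refine (measure_mono (t := {z | z ∈ K ∧ |slopeFrom x' z - slopeFrom x' y₀| ≤ Δ})
        fun z hz => ⟨hz.1.1, ?_⟩).trans (measure_slope_near_le h' hu0 hu1 hM hy₀.2.2 le_rfl)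
      have hz2 := mem_closedBall.1 (mem_preimage.1 hz.2)
      rw [Prod.dist_eq, max_le_iff, Real.dist_eq, Real.dist_eq] at hz2
      simp only [lineAt] at hz2
      have := abs_sub_le (slopeFrom x' z) (slopeFrom x y) (slopeFrom x' y₀)
      rw [abs_sub_comm (slopeFrom x y)] at this
      linarith [hz2.1, hd.1]
  have hmeas : ν (S ∩ D) ≤ ENNReal.ofReal (48 * M * Δ ^ u * max Δ (dist x' x) ^ (-u)) := by
    by_cases hv : dist x' x ≤ 12 * Δ
    · refine prob_le_one.trans ?_
      rw [← ENNReal.ofReal_one]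
      refine ENNReal.ofReal_le_ofReal ?_
      have hpos : 0 < max Δ (dist x' x) := lt_max_of_lt_left hΔ0
      have h1 : max Δ (dist x' x) ^ u ≤ 12 * Δ ^ u := by
        calc max Δ (dist x' x) ^ u ≤ (12 * Δ) ^ u := by
              gcongr
              exact max_le (by linarith) hv
          _ = 12 ^ u * Δ ^ u := Real.mul_rpow (by norm_num) hΔ0.le
          _ ≤ 12 ^ (1 : ℝ) * Δ ^ u := by
              gcongr
              norm_num
          _ = 12 * Δ ^ u := by rw [Real.rpow_one]
      rw [Real.rpow_neg hpos.le, ← div_eq_mul_inv, le_div_iff₀ (by positivity)]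
      have : 0 < Δ ^ u := by positivity
      nlinarith
    · push Not at hv
      have hd0 : 0 < dist x' x := by linarith
      rcases (S ∩ D).eq_empty_or_nonempty with he | ⟨y₀, hy₀S, hy₀⟩
      · rw [he, measure_empty]
        exact zero_le
      · have hd2 : dist x' x ≤ 2 := by
          rw [dist_eq_norm]
          exact (norm_sub_le _ _).trans (by linarith [h.1, h'.1])
        have hv1 : dist x' x / 3 ≤ |x'.1 - x.1| := by
          have ha := h.abs_slopeFrom_le hy₀.1
          have hy₀S : |x'.2 - x.2 - slopeFrom x y₀ * (x'.1 - x.1)| ≤ Δ := hy₀S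
          have h2 : |x'.2 - x.2| ≤ Δ + 2 * |x'.1 - x.1| := by
            have := abs_add_le (x'.2 - x.2 - slopeFrom x y₀ * (x'.1 - x.1))
              (slopeFrom x y₀ * (x'.1 - x.1))
            rw [sub_add_cancel, abs_mul] at this
            have : |slopeFrom x y₀| * |x'.1 - x.1| ≤ 2 * |x'.1 - x.1| := by gcongr
            linarith
          have h3 : dist x' x ≤ Δ + 2 * |x'.1 - x.1| := by
            rw [Prod.dist_eq, Real.dist_eq, Real.dist_eq]
            exact max_le (by linarith [abs_nonneg (x'.1 - x.1)]) h2
          linarith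
        refine (measure_mono (t := {z | z ∈ K ∧
          |slopeFrom x z - slopeFrom x y₀| ≤ 6 * Δ / dist x' x}) fun z hz => ⟨hz.2.1, ?_⟩).trans
          ((measure_slope_near_le h hu0 hu1 hM hy₀.2.2
            (r := 6 * Δ / dist x' x) ?_).trans ?_)
        · have hzS : |x'.2 - x.2 - slopeFrom x z * (x'.1 - x.1)| ≤ Δ := hz.1
          have hy₀S : |x'.2 - x.2 - slopeFrom x y₀ * (x'.1 - x.1)| ≤ Δ := hy₀S
          have h2 : |slopeFrom x z - slopeFrom x y₀| * |x'.1 - x.1| ≤ 2 * Δ := by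
            rw [← abs_mul]
            have e : (slopeFrom x z - slopeFrom x y₀) * (x'.1 - x.1) =
              (x'.2 - x.2 - slopeFrom x y₀ * (x'.1 - x.1)) -
                (x'.2 - x.2 - slopeFrom x z * (x'.1 - x.1)) := by ring
            rw [e]
            exact (abs_sub _ _).trans (by linarith)
          rw [le_div_iff₀ hd0]
          have := mul_le_mul_of_nonneg_left hv1 (abs_nonneg (slopeFrom x z - slopeFrom x y₀))
          linarith
        · rw [← hΔ, le_div_iff₀ hd0]
          nlinarith
        · refine ENNReal.ofReal_le_ofReal ?_
          rw [max_eq_right (by linarith), Real.div_rpow (by positivity) hd0.le,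
            Real.mul_rpow (by norm_num) hΔ0.le, Real.rpow_neg hd0.le]
          have : (6 : ℝ) ^ u ≤ 6 := by
            calc (6 : ℝ) ^ u ≤ 6 ^ (1 : ℝ) := by
                  gcongr
                  norm_num
              _ = 6 := Real.rpow_one _
          calc 8 * M * (6 ^ u * Δ ^ u / dist x' x ^ u) ≤
              8 * M * (6 * Δ ^ u / dist x' x ^ u) := by gcongr
            _ = _ := by ring
  calc _ ≤ ∫⁻ y in D, S.indicator (fun _ => ENNReal.ofReal (8 * M * Δ ^ u)) y ∂ν :=
        setLIntegral_mono' hDm hpoint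
    _ = ENNReal.ofReal (8 * M * Δ ^ u) * ν (S ∩ D) := by
        rw [lintegral_indicator_const hSm, Measure.restrict_apply hSm]
    _ ≤ ENNReal.ofReal (8 * M * Δ ^ u) *
        ENNReal.ofReal (48 * M * Δ ^ u * max Δ (dist x' x) ^ (-u)) := by gcongr
    _ = _ := by
        rw [← ENNReal.ofReal_mul (by positivity), two_mul u, Real.rpow_add hΔ0]
        congr 1
        ring

end

lemma sum_mul_max_rpow_neg_le {E : Type*} [MetricSpace E] [MeasurableSpace E] [BorelSpace E]
    {P : Finset E} {w : E → ℝ} (hw : ∀ p, 0 ≤ w p) {Δ C s u : ℝ} (hΔ : 0 < Δ) (hC : 0 ≤ C)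
    (hu : 0 ≤ u) (hsu : s < u) {p : E}
    (hreg : ∀ r, Δ ≤ r → ∑ q ∈ P with dist q p ≤ r, w q ≤ C * r ^ s) :
    ∑ q ∈ P, ENNReal.ofReal (w q) * ENNReal.ofReal (max Δ (dist q p) ^ (-u)) ≤
      ENNReal.ofReal (2 ^ u / (1 - 2 ^ (s - u)) * C * Δ ^ (s - u)) := by
  classical
  refine le_trans (le_of_eq ?_) (lintegral_max_rpow_neg_le (E := E) (p := p)
    (ν := ∑ q ∈ P, ENNReal.ofReal (w q) • Measure.dirac q) hΔ hC hu hsu fun r hr => ?_)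
  · rw [lintegral_finsetSum_measure]
    refine Finset.sum_congr rfl fun q _ => ?_
    rw [lintegral_smul_measure, lintegral_dirac, smul_eq_mul]
  · rw [Measure.coe_finsetSum, Finset.sum_apply]
    refine le_trans (le_of_eq ?_) (ENNReal.ofReal_le_ofReal (hreg r hr))
    rw [ENNReal.ofReal_sum_of_nonneg fun q _ => hw q, Finset.sum_filter]
    refine Finset.sum_congr rfl fun q _ => ?_
    rw [Measure.smul_apply, Measure.dirac_apply' _ measurableSet_closedBall, smul_eq_mul]
    by_cases hq : dist q p ≤ r
    · rw [if_pos hq, indicator_of_mem (mem_closedBall.2 hq), Pi.one_apply, mul_one]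
    · rw [if_neg hq, indicator_of_notMem (fun h => hq (mem_closedBall.1 h)), mul_zero]

/-- Superposition of the heavy lines through the points of `P`. -/
def heavyLines (ν : Measure (ℝ × ℝ)) (K : Set (ℝ × ℝ)) (u M : ℝ) (j : ℕ) (P : Finset (ℝ × ℝ))
    (w : ℝ × ℝ → ℝ) : Measure (ℝ × ℝ) :=
  ∑ x ∈ P, ENNReal.ofReal (w x) •
    (ν.restrict (heavyAt ν K u M x j)).map fun y => lineAt x (slopeFrom x y)

lemma measurable_lineAt_slopeFrom (x : ℝ × ℝ) : Measurable fun y => lineAt x (slopeFrom x y) :=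
  (continuous_lineAt x).measurable.comp (measurable_slopeFrom x)

lemma heavyLines_apply {ν : Measure (ℝ × ℝ)} {K : Set (ℝ × ℝ)} {u M : ℝ} {j : ℕ} {P : Finset (ℝ × ℝ)}
    {w : ℝ × ℝ → ℝ} {S : Set (ℝ × ℝ)} (hS : MeasurableSet S) :
    heavyLines ν K u M j P w S = ∑ x ∈ P, ENNReal.ofReal (w x) *
      ν (heavyAt ν K u M x j ∩ (fun y => lineAt x (slopeFrom x y)) ⁻¹' S) := by
  rw [heavyLines, Measure.coe_finsetSum, Finset.sum_apply]
  refine Finset.sum_congr rfl fun x _ => ?_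
  rw [Measure.smul_apply, smul_eq_mul, Measure.map_apply (measurable_lineAt_slopeFrom x) hS,
    Measure.restrict_apply (measurable_lineAt_slopeFrom x hS), inter_comm]

section

variable {ν : Measure (ℝ × ℝ)} [IsProbabilityMeasure ν]

lemma continuous_lineAvg {Δ : ℝ} (hΔ : 0 < Δ) : Continuous (lineAvg Δ ν) := by
  have hc := continuous_tentDiff Δ
  refine continuous_of_dominated (bound := fun _ => Δ⁻¹) (fun ℓ => ?_) (fun ℓ => ?_)
    (integrable_const _) ?_
  · have : Continuous fun z : ℝ × ℝ => tentDiff Δ (ℓ.2 - z.2 + ℓ.1 * z.1) := by fun_prop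
    exact this.aestronglyMeasurable
  · exact Filter.Eventually.of_forall fun z => abs_tentDiff_le hΔ _
  · exact Filter.Eventually.of_forall fun z => by fun_prop

lemma isFiniteMeasure_heavyLines {K : Set (ℝ × ℝ)} {u M : ℝ} {j : ℕ} {P : Finset (ℝ × ℝ)}
    {w : ℝ × ℝ → ℝ} : IsFiniteMeasure (heavyLines ν K u M j P w) := by
  refine ⟨?_⟩
  rw [heavyLines_apply MeasurableSet.univ]
  exact ENNReal.sum_lt_top.2 fun x _ => ENNReal.mul_lt_top ENNReal.ofReal_lt_top
    (measure_lt_top _ _)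

lemma lintegral_heavyLines_closedBall_le {K : Set (ℝ × ℝ)} (hK : MeasurableSet K) {u M : ℝ}
    (hu0 : 0 < u) (hu1 : u < 1) (hM : 1 ≤ M) {j : ℕ} {P : Finset (ℝ × ℝ)} {w : ℝ × ℝ → ℝ}
    (hP : ∀ x ∈ P, SeenFrom x K) (hw : ∀ p, 0 ≤ w p) (hw1 : ∑ p ∈ P, w p = 1)
    {C s : ℝ} (hC : 0 ≤ C) (hsu : s < u)
    (hreg : ∀ p ∈ P, ∀ r, (1 / 2) ^ j ≤ r → ∑ q ∈ P with dist q p ≤ r, w q ≤ C * r ^ s)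
    {r : ℝ} (hr : r ≤ (1 / 2) ^ j / 4) :
    ∫⁻ ℓ, heavyLines ν K u M j P w (closedBall ℓ r) ∂heavyLines ν K u M j P w ≤
      ENNReal.ofReal (384 * M ^ 2 * ((1 / 2) ^ j) ^ (2 * u) *
        (2 ^ u / (1 - 2 ^ (s - u)) * C * ((1 / 2) ^ j) ^ (s - u))) := by
  have hΔ : (0 : ℝ) < (1 / 2) ^ j := by positivity
  set Δ : ℝ := (1 / 2) ^ j with hΔdef
  set B : ℝ := 384 * M ^ 2 * Δ ^ (2 * u) with hB
  have hB0 : 0 ≤ B := by positivity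
  have hinner : ∀ x ∈ P, ∫⁻ y in heavyAt ν K u M x j,
      heavyLines ν K u M j P w (closedBall (lineAt x (slopeFrom x y)) r) ∂ν ≤
      ENNReal.ofReal (B * (2 ^ u / (1 - 2 ^ (s - u)) * C * Δ ^ (s - u))) := by
    intro x hx
    simp_rw [heavyLines_apply measurableSet_closedBall]
    have hm : ∀ x' : ℝ × ℝ, Measurable fun y => ν (heavyAt ν K u M x' j ∩
        (fun y' => lineAt x' (slopeFrom x' y')) ⁻¹' closedBall (lineAt x (slopeFrom x y)) r) := by
      intro x'
      have hms : MeasurableSet {q : (ℝ × ℝ) × (ℝ × ℝ) | q.2 ∈ heavyAt ν K u M x' j ∧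
          dist (lineAt x' (slopeFrom x' q.2)) (lineAt x (slopeFrom x q.1)) ≤ r} :=
        (measurable_snd (measurableSet_heavyAt hK u M x' j)).inter (measurableSet_le
          (((measurable_lineAt_slopeFrom x').comp measurable_snd).dist
            ((measurable_lineAt_slopeFrom x).comp measurable_fst)) measurable_const)
      exact measurable_measure_prodMk_left hms
    rw [lintegral_finsetSum _ fun x' _ => (hm x').const_mul _]
    calc _ ≤ ∑ x' ∈ P, ENNReal.ofReal (w x') *
          ENNReal.ofReal (B * max Δ (dist x' x) ^ (-u)) := by
          refine Finset.sum_le_sum fun x' hx' => ?_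
          rw [lintegral_const_mul' _ _ ENNReal.ofReal_ne_top]
          gcongr
          exact lintegral_heavyAt_le (hP x hx) (hP x' hx') hK hu0 hu1 hM hr
      _ = ENNReal.ofReal B * ∑ x' ∈ P, ENNReal.ofReal (w x') *
          ENNReal.ofReal (max Δ (dist x' x) ^ (-u)) := by
          rw [Finset.mul_sum]
          refine Finset.sum_congr rfl fun x' _ => ?_
          rw [ENNReal.ofReal_mul hB0]
          ring
      _ ≤ ENNReal.ofReal B *
          ENNReal.ofReal (2 ^ u / (1 - 2 ^ (s - u)) * C * Δ ^ (s - u)) := by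
          gcongr
          exact sum_mul_max_rpow_neg_le hw hΔ hC hu0.le hsu (hreg x hx)
      _ = _ := (ENNReal.ofReal_mul hB0).symm
  calc _ = ∑ x ∈ P, ENNReal.ofReal (w x) * ∫⁻ ℓ, heavyLines ν K u M j P w (closedBall ℓ r)
        ∂(ν.restrict (heavyAt ν K u M x j)).map fun y => lineAt x (slopeFrom x y) := by
        conv_lhs => enter [1]; rw [heavyLines]
        rw [lintegral_finsetSum_measure]
        refine Finset.sum_congr rfl fun x _ => ?_
        rw [lintegral_smul_measure, smul_eq_mul]
    _ ≤ ∑ x ∈ P, ENNReal.ofReal (w x) *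
        ENNReal.ofReal (B * (2 ^ u / (1 - 2 ^ (s - u)) * C * Δ ^ (s - u))) := by
        refine Finset.sum_le_sum fun x hx => ?_
        gcongr
        exact (lintegral_map_le _ _).trans (hinner x hx)
    _ = _ := by
        rw [← Finset.sum_mul, ← ENNReal.ofReal_sum_of_nonneg fun q _ => hw q, hw1,
          ENNReal.ofReal_one, one_mul]

/-- Quantitative bound for heavy directions at a single scale. -/
lemma sq_le_of_forall_heavyAt {K A : Set (ℝ × ℝ)} (hK : MeasurableSet K) (hνK : ν Kᶜ = 0)
    (hA : ∀ x ∈ A, SeenFrom x K) {C t : ℝ} (hC : 0 ≤ C) (ht : t < 2)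
    (hν : ∀ p r, 0 < r → ν (closedBall p r) ≤ ENNReal.ofReal (C * r ^ t)) {s u c : ℝ}
    (hs : 0 ≤ s) (hsu : s < u) (hu1 : u < 1) (hc : 0 < c) (hcA : BallContentGE s c A) {M : ℝ}
    (hM : 1 ≤ M) {j : ℕ} (hj : 0 < j) {δ : ℝ} (hδ : 0 ≤ δ)
    (hδA : ∀ x ∈ A, ENNReal.ofReal δ ≤ ν (heavyAt ν K u M x j)) {κ : ℝ}
    (hκ : κ = 1 - 2 ^ (u - 1)) :
    κ ^ 4 / 1024 ^ 2 * δ ^ 2 ≤ 2 * 4096 * (2 ^ (2 : ℝ) / (1 - 2 ^ (t - 2)) * C) *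
      (384 * (2 ^ u / (1 - 2 ^ (s - u)) * (6 ^ s / c))) * ((1 / 2) ^ j) ^ (s + t - 1 - u) := by
  have hu0 : 0 < u := hs.trans_lt hsu
  have hΔ : (0 : ℝ) < (1 / 2) ^ j := by positivity
  have hΔ1 : (1 / 2 : ℝ) ^ j ≤ 1 := pow_le_one₀ (by norm_num) (by norm_num)
  have hκ0 : 0 < κ := by
    rw [hκ, sub_pos]
    exact Real.rpow_lt_one_of_one_lt_of_neg (by norm_num) (by linarith)
  have hκ1 : κ ≤ 1 := by
    have : (0 : ℝ) < 2 ^ (u - 1) := by positivity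
    linarith
  have ht0 : (2 : ℝ) ^ (t - 2) < 1 :=
    Real.rpow_lt_one_of_one_lt_of_neg (by norm_num) (by linarith)
  have hsu0 : (2 : ℝ) ^ (s - u) < 1 :=
    Real.rpow_lt_one_of_one_lt_of_neg (by norm_num) (by linarith)
  have hAb : TotallyBounded A := by
    refine (isCompact_closedBall (0 : ℝ × ℝ) 1).totallyBounded.subset fun x hx => ?_
    rw [mem_closedBall_zero_iff]
    exact (hA x hx).1
  obtain ⟨P, w, hPA, hw, hw1, hreg⟩ := exists_discrete_frostman hs hc hAb hcA hΔ
  have hPs : ∀ x ∈ P, SeenFrom x K := fun x hx => hA x (hPA hx)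
  have hν1 : ν (closedBall 0 1)ᶜ = 0 := by
    have hPne : P.Nonempty := by
      rw [Finset.nonempty_iff_ne_empty]
      rintro rfl
      simp at hw1
    obtain ⟨x, hx⟩ := hPne
    refine measure_mono_null (compl_subset_compl.2 fun z hz => ?_) hνK
    rw [mem_closedBall_zero_iff]
    exact ((hPs x hx).2 z hz).1
  have hfin : IsFiniteMeasure (heavyLines ν K u M j P w) := isFiniteMeasure_heavyLines
  set Δ : ℝ := (1 / 2) ^ j with hΔdef
  set r : ℝ := κ / 1024 * Δ with hr
  have hr0 : 0 < r := by positivity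
  have hrΔ : r ≤ Δ / 1024 := by
    rw [hr]
    nlinarith
  set m : ℝ := κ / 2 * (M * Δ ^ (u - 1)) with hm
  set S : Set (ℝ × ℝ) := (Icc (-2) 2 ×ˢ Icc (-3) 3) ∩
    ⋂ v ∈ closedBall (0 : ℝ × ℝ) r, {ℓ | m ≤ |lineAvg Δ ν (ℓ + v)|} with hS
  have hSm : MeasurableSet S := by
    have hcl := continuous_lineAvg (ν := ν) hΔ
    refine ((isClosed_Icc.prod isClosed_Icc).inter
      (isClosed_biInter fun v _ => isClosed_le continuous_const ?_)).measurableSet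
    fun_prop
  have hmem : ∀ x ∈ P, ∀ y ∈ heavyAt ν K u M x j, lineAt x (slopeFrom x y) ∈ S := by
    intro x hx y hy
    have ha := abs_le.1 ((hPs x hx).abs_slopeFrom_le hy.1)
    have h2 : |x.2 - slopeFrom x y * x.1| ≤ 3 := by
      have hx1 : |x.1| ≤ 1 := (norm_fst_le x).trans (hPs x hx).1
      have hx2 : |x.2| ≤ 1 := (norm_snd_le x).trans (hPs x hx).1
      refine (abs_sub _ _).trans ?_
      rw [abs_mul]
      have : |slopeFrom x y| * |x.1| ≤ 2 * 1 := by
        gcongr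
        exact (hPs x hx).abs_slopeFrom_le hy.1
      linarith
    refine ⟨⟨ha, abs_le.1 h2⟩, mem_iInter₂.2 fun v hv => ?_⟩
    refine le_abs_lineAvg_of_mem_heavyAt (hPs x hx) hK hνK hu0 hu1 hM hκ hj hy ?_
    rw [mem_closedBall, dist_eq_norm, add_sub_cancel_left]
    exact mem_closedBall_zero_iff.1 hv
  have hSc : heavyLines ν K u M j P w Sᶜ = 0 := by
    rw [heavyLines_apply hSm.compl]
    refine Finset.sum_eq_zero fun x hx => ?_
    have : heavyAt ν K u M x j ∩ (fun y => lineAt x (slopeFrom x y)) ⁻¹' Sᶜ = ∅ := by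
      rw [eq_empty_iff_forall_notMem]
      exact fun y hy => hy.2 (hmem x hx y hy.1)
    rw [this, measure_empty, mul_zero]
  have htot : ENNReal.ofReal δ ≤ heavyLines ν K u M j P w univ := by
    rw [heavyLines_apply MeasurableSet.univ]
    calc ENNReal.ofReal δ = ∑ x ∈ P, ENNReal.ofReal (w x) * ENNReal.ofReal δ := by
          rw [← Finset.sum_mul, ← ENNReal.ofReal_sum_of_nonneg fun q _ => hw q, hw1,
            ENNReal.ofReal_one, one_mul]
      _ ≤ _ := by
          refine Finset.sum_le_sum fun x hx => ?_
          rw [preimage_univ, inter_univ]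
          gcongr
          exact hδA x (hPA hx)
  have hmain := sq_mul_measure_sq_le (measurable_lineAvg Δ ν) hSc
    (measurableSet_Icc.prod measurableSet_Icc : MeasurableSet (Icc (-4 : ℝ) 4 ×ˢ Icc (-11 : ℝ) 11))
    (m := m) hr0 (fun ℓ hℓ p hp => by
      have hd := mem_closedBall.1 hp
      rw [Prod.dist_eq, max_le_iff, Real.dist_eq, Real.dist_eq, abs_le, abs_le] at hd
      obtain ⟨⟨⟨h1, h2⟩, h3, h4⟩, -⟩ := hℓ
      exact ⟨⟨by linarith, by linarith⟩, by linarith, by linarith⟩)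
    (fun ℓ hℓ p hp => by
      have := mem_iInter₂.1 hℓ.2 (p - ℓ) (by
        rw [mem_closedBall_zero_iff, ← dist_eq_norm]
        exact mem_closedBall.1 hp)
      rwa [mem_ofPred_eq, add_sub_cancel] at this)
  have hE := lintegral_heavyLines_closedBall_le (ν := ν) hK hu0 hu1 hM hPs hw hw1
    (by positivity : 0 ≤ 6 ^ s / c) hsu hreg (r := 2 * r) (by linarith)
  have hL := lintegral_lineAvg_sq_le hC ht hν1 hν hΔ hΔ1
  have h1 : ENNReal.ofReal (m ^ 2 * (4 * r ^ 2) * δ ^ 2) ≤ ENNReal.ofReal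
      (2 * 4096 * (2 ^ (2 : ℝ) / (1 - 2 ^ (t - 2)) * C) * Δ ^ (t - 1) *
        (384 * M ^ 2 * Δ ^ (2 * u) *
          (2 ^ u / (1 - 2 ^ (s - u)) * (6 ^ s / c) * Δ ^ (s - u)))) := by
    have hm0 : 0 ≤ m := by positivity
    have h2t : 0 < 1 - (2 : ℝ) ^ (t - 2) := by linarith
    calc ENNReal.ofReal (m ^ 2 * (4 * r ^ 2) * δ ^ 2)
        = ENNReal.ofReal m ^ 2 * ENNReal.ofReal (4 * r ^ 2) * ENNReal.ofReal δ ^ 2 := by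
          rw [ENNReal.ofReal_mul (by positivity), ENNReal.ofReal_mul (by positivity),
            ENNReal.ofReal_pow hm0, ENNReal.ofReal_pow hδ]
      _ ≤ ENNReal.ofReal m ^ 2 * ENNReal.ofReal (4 * r ^ 2) *
          heavyLines ν K u M j P w univ ^ 2 := by gcongr
      _ ≤ _ := hmain.trans (mul_le_mul' hL hE)
      _ = _ := (ENNReal.ofReal_mul (by positivity)).symm
  have h2t : 0 < 1 - (2 : ℝ) ^ (t - 2) := by linarith
  have h2s : 0 < 1 - (2 : ℝ) ^ (s - u) := by linarith
  rw [ENNReal.ofReal_le_ofReal_iff (by positivity)] at h1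
  have e1 : Δ ^ (s + t - 1 - u) * Δ ^ (2 * u) = Δ ^ (t - 1) * Δ ^ (2 * u) * Δ ^ (s - u) := by
    rw [← Real.rpow_add hΔ, ← Real.rpow_add hΔ, ← Real.rpow_add hΔ]
    congr 1
    ring
  have e2 : (Δ ^ (u - 1)) ^ 2 * Δ ^ 2 = Δ ^ (2 * u) := by
    rw [Real.rpow_sub_one hΔ.ne', two_mul, Real.rpow_add hΔ]
    field_simp
  have hpos : 0 < M ^ 2 * Δ ^ (2 * u) := by positivity
  refine le_of_mul_le_mul_right ?_ hpos
  calc κ ^ 4 / 1024 ^ 2 * δ ^ 2 * (M ^ 2 * Δ ^ (2 * u)) = m ^ 2 * (4 * r ^ 2) * δ ^ 2 := by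
        rw [hm, hr, ← e2]
        ring
    _ ≤ _ := h1
    _ = 2 * 4096 * (2 ^ (2 : ℝ) / (1 - 2 ^ (t - 2)) * C) *
      (384 * (2 ^ u / (1 - 2 ^ (s - u)) * (6 ^ s / c))) * M ^ 2 *
        (Δ ^ (t - 1) * Δ ^ (2 * u) * Δ ^ (s - u)) := by ring
    _ = _ := by
        rw [← e1]
        ring

end

/-- Some centre in `X` sees a set of slopes of positive `u`-dimensional measure. -/
theorem exists_hausdorffMeasure_slopeFrom_ne_zero {X Y : Set (ℝ × ℝ)} (hY : MeasurableSet Y)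
    (hXY : ∀ x ∈ X, SeenFrom x Y) {s t u : ℝ} (hs : 0 ≤ s) (hsu : s < u) (hu1 : u < 1)
    (ht0 : 0 < t) (ht : t < 2) (hust : u < s + t - 1) (hXs : μH[s] X ≠ 0) (hYt : μH[t] Y ≠ 0) :
    ∃ x ∈ X, μH[u] (slopeFrom x '' Y) ≠ 0 := by
  by_contra! hnull
  have hu0 : 0 < u := hs.trans_lt hsu
  obtain ⟨K, hKY, hK, cK, hcK, hKc⟩ := exists_isCompact_ballContentGE ht0 hY hYt
  obtain ⟨C, hC, ν, hν, hνK, hνC⟩ := exists_frostman_measure ht0.le hcK hK hKc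
  have hXK : ∀ x ∈ X, SeenFrom x K := fun x hx => ⟨(hXY x hx).1, fun z hz => (hXY x hx).2 z (hKY hz)⟩
  set η : ℝ := s + t - 1 - u with hη
  have hη0 : 0 < η := by linarith
  set b : ℕ → ℝ := fun j => ((1 / 2) ^ j) ^ (η / 6) with hb
  have hb0 : ∀ j, 0 < b j := fun j => by positivity
  set q : ℝ := (1 / 2) ^ (η / 6) with hq
  have hq0 : 0 < q := by positivity
  have hq1 : q < 1 := Real.rpow_lt_one (by norm_num) (by norm_num) (by positivity)
  have hbq : ∀ j, b j = q ^ j := fun j => by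
    simp only [hb, hq]
    rw [← Real.rpow_natCast, ← Real.rpow_natCast, ← Real.rpow_mul (by norm_num),
      ← Real.rpow_mul (by norm_num), mul_comm]
  have hbs : Summable b := by
    simp_rw [funext hbq]
    exact summable_geometric_of_lt_one hq0.le hq1
  have hbsum : ∑' j, b j = (1 - q)⁻¹ := by
    simp_rw [hbq]
    exact tsum_geometric_of_lt_one hq0.le hq1
  obtain ⟨c, hc, hcover⟩ := exists_ballContentGE_of_subset_iUnion hs hXs hb0 hbs
  set c₀ : ℝ := (1 - q) / 2 with hc₀
  have hc₀0 : 0 < c₀ := by linarith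
  set κ : ℝ := 1 - 2 ^ (u - 1) with hκ
  have hκ0 : 0 < κ := by
    rw [hκ, sub_pos]
    exact Real.rpow_lt_one_of_one_lt_of_neg (by norm_num) (by linarith)
  have hsu0 : 0 < 1 - (2 : ℝ) ^ (s - u) :=
    sub_pos.2 (Real.rpow_lt_one_of_one_lt_of_neg (by norm_num) (by linarith))
  have ht2 : 0 < 1 - (2 : ℝ) ^ (t - 2) :=
    sub_pos.2 (Real.rpow_lt_one_of_one_lt_of_neg (by norm_num) (by linarith))
  set A : ℝ := 2 * 4096 * (2 ^ (2 : ℝ) / (1 - 2 ^ (t - 2)) * C) *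
    (384 * (2 ^ u / (1 - 2 ^ (s - u)) * (6 ^ s / c))) with hA
  have hA0 : 0 < A := by positivity
  have hkey : ∀ M : ℝ, 1 < M → κ ^ 4 / 1024 ^ 2 * c₀ ^ 2 ≤ A * M ^ (-(η / (2 * u))) := by
    intro M hM
    have hM0 : 0 < M := by linarith
    obtain ⟨j, hj⟩ := hcover
      (fun j => {x | x ∈ X ∧ ENNReal.ofReal (c₀ * b j) ≤ ν (heavyAt ν K u M x j)}) fun x hx => by
        by_contra hcon
        simp only [mem_iUnion, mem_ofPred_eq, not_exists, not_and, not_le] at hcon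
        have h1 := measure_iUnion_heavyAt (ν := ν) hK hνK (hXK x hx) hu0 hu1 hM.le
          (measure_mono_null (image_mono hKY) (hnull x hx))
        have h2 : ν (⋃ j, heavyAt ν K u M x j) ≤ ENNReal.ofReal (1 / 2) := by
          refine (measure_iUnion_le _).trans ((ENNReal.tsum_le_tsum fun j =>
            (hcon j hx).le).trans (le_of_eq ?_))
          rw [← ENNReal.ofReal_tsum_of_nonneg (fun j => by have := hb0 j; positivity)
            (hbs.mul_left c₀), tsum_mul_left, hbsum, hc₀]
          congr 1
          have : 1 - q ≠ 0 := by linarith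
          field_simp
        have h3 := h1.trans h2
        rw [ENNReal.one_le_ofReal] at h3
        norm_num at h3
    set Δ : ℝ := (1 / 2) ^ j with hΔ
    have hΔ0 : 0 < Δ := by positivity
    obtain ⟨x, hx⟩ : {x | x ∈ X ∧ ENNReal.ofReal (c₀ * b j) ≤ ν (heavyAt ν K u M x j)}.Nonempty := by
      by_contra! he
      have := hj ∅ (by simp) (by rw [he]; simp)
      rw [Finset.sum_empty] at this
      have h4 := mul_pos hc (hb0 j)
      linarith
    obtain ⟨y, hy⟩ : (heavyAt ν K u M x j).Nonempty := by
      by_contra! he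
      have := hx.2
      rw [he, measure_empty, nonpos_iff_eq_zero, ENNReal.ofReal_eq_zero] at this
      have h4 := mul_pos hc₀0 (hb0 j)
      linarith
    have hMΔ : M * Δ ^ u ≤ 1 := by
      have h5 := hy.2.1.trans (tentAvg_le hΔ0 _)
      rw [← hΔ, Real.rpow_sub_one hΔ0.ne'] at h5
      rw [← mul_div_assoc, div_le_iff₀ hΔ0, inv_mul_cancel₀ hΔ0.ne'] at h5
      exact h5
    have hj0 : 0 < j := by
      rcases Nat.eq_zero_or_pos j with rfl | h
      · rw [hΔ, pow_zero, Real.one_rpow] at hMΔ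
        linarith
      · exact h
    have h6 := sq_le_of_forall_heavyAt (ν := ν) hK.measurableSet hνK (fun x hx => hXK x hx.1) hC.le
      ht hνC hs hsu hu1 (mul_pos hc (hb0 j)) hj hM.le hj0 (mul_pos hc₀0 (hb0 j)).le
      (fun x hx => hx.2) hκ
    rw [← hΔ, ← hη] at h6
    have e3 : b j ^ 3 * Δ ^ (η / 2) = Δ ^ η := by
      simp only [hb]
      rw [← hΔ, ← Real.rpow_natCast, ← Real.rpow_mul hΔ0.le, ← Real.rpow_add hΔ0]
      congr 1
      push_cast
      ring
    have hbj := hb0 j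
    have h7 : κ ^ 4 / 1024 ^ 2 * c₀ ^ 2 ≤ A * Δ ^ (η / 2) := by
      have hb3 : 0 < b j ^ 2 := by positivity
      refine le_of_mul_le_mul_right ?_ hb3
      calc κ ^ 4 / 1024 ^ 2 * c₀ ^ 2 * b j ^ 2 = κ ^ 4 / 1024 ^ 2 * (c₀ * b j) ^ 2 := by ring
        _ ≤ _ := h6
        _ = A * Δ ^ (η / 2) * b j ^ 2 := by
          rw [← e3, hA]
          field_simp
    refine h7.trans ?_
    gcongr
    have h8 : Δ ^ u ≤ M⁻¹ := by
      rw [← one_div, le_div_iff₀ hM0, mul_comm]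
      exact hMΔ
    calc Δ ^ (η / 2) = (Δ ^ u) ^ (η / (2 * u)) := by
          rw [← Real.rpow_mul hΔ0.le]
          congr 1
          field_simp
      _ ≤ M⁻¹ ^ (η / (2 * u)) := by gcongr
      _ = _ := by rw [Real.inv_rpow hM0.le, Real.rpow_neg hM0.le]
  have hlim : Filter.Tendsto (fun M : ℝ => A * M ^ (-(η / (2 * u)))) Filter.atTop (nhds (A * 0)) :=
    (tendsto_rpow_neg_atTop (by positivity)).const_mul A
  rw [mul_zero] at hlim
  have hpos : 0 < κ ^ 4 / 1024 ^ 2 * c₀ ^ 2 := by positivity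
  obtain ⟨M, hM, hM1⟩ := ((hlim.eventually (gt_mem_nhds hpos)).and
    (Filter.eventually_gt_atTop (1 : ℝ))).exists
  exact absurd (hkey M hM1) (not_le.2 hM)

lemma lipschitzOnWith_div_coord (i k : Fin 2) :
    LipschitzOnWith 18 (fun e : E2 => e k / e i) {e | ‖e‖ ≤ 1 ∧ 1 / 3 ≤ |e i|} := by
  refine LipschitzOnWith.of_dist_le_mul fun e he e' he' => ?_
  have hcoord : ∀ (v : E2) (p : Fin 2), |v p| ≤ ‖v‖ := fun v p => PiLp.norm_apply_le v p
  have h1 : 0 < |e i| := by linarith [he.2]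
  have h2 : 0 < |e' i| := by linarith [he'.2]
  have h1' := abs_pos.1 h1
  have h2' := abs_pos.1 h2
  rw [Real.dist_eq, dist_eq_norm]
  have e1 : e k / e i - e' k / e' i =
      ((e - e') k * e' i - e' k * (e - e') i) / (e i * e' i) := by
    simp only [PiLp.sub_apply]
    field_simp
    ring
  rw [e1, abs_div, abs_mul (e i), div_le_iff₀ (by positivity)]
  have h3 : |(e - e') k * e' i| ≤ ‖e - e'‖ * 1 := by
    rw [abs_mul]
    gcongr
    · exact hcoord _ _
    · exact (hcoord _ _).trans he'.1
  have h4 : |e' k * (e - e') i| ≤ 1 * ‖e - e'‖ := by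
    rw [abs_mul]
    gcongr
    · exact (hcoord _ _).trans he'.1
    · exact hcoord _ _
  have h5 : 1 / 9 ≤ |e i| * |e' i| := by
    have := he.2
    have := he'.2
    nlinarith
  have h6 : 0 ≤ ‖e - e'‖ := norm_nonneg _
  refine (abs_sub _ _).trans ?_
  push_cast
  nlinarith

/-- Affine chart taking coordinates `i, k` around `x₀` at scale `2 d`. -/
def coordChart (i k : Fin 2) (x₀ : E2) (d : ℝ) (v : E2) : ℝ × ℝ :=
  ((v i - x₀ i) / (2 * d), (v k - x₀ k) / (2 * d))

lemma continuous_coordChart (i k : Fin 2) (x₀ : E2) (d : ℝ) :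
    Continuous (coordChart i k x₀ d) := by
  unfold coordChart
  fun_prop

lemma antilipschitzWith_coordChart {i k : Fin 2} (hik : i ≠ k) (x₀ : E2) {d : ℝ} (hd : 0 < d) :
    AntilipschitzWith (4 * d).toNNReal (coordChart i k x₀ d) := by
  refine AntilipschitzWith.of_le_mul_dist fun v w => ?_
  rw [Real.coe_toNNReal _ (by positivity), Prod.dist_eq, Real.dist_eq, Real.dist_eq]
  have e : ∀ p, (v p - x₀ p) / (2 * d) - (w p - x₀ p) / (2 * d) = (v p - w p) / (2 * d) :=
    fun p => by ring
  simp only [coordChart, e, abs_div, abs_of_pos (by positivity : 0 < 2 * d)]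
  have h1 : dist v w ≤ |v i - w i| + |v k - w k| := by
    rw [EuclideanSpace.dist_eq]
    refine Real.sqrt_le_iff.2 ⟨by positivity, ?_⟩
    have hsum : ∑ p, dist (v p) (w p) ^ 2 = |v i - w i| ^ 2 + |v k - w k| ^ 2 := by
      simp only [Fin.sum_univ_two, Real.dist_eq]
      fin_cases i <;> fin_cases k <;> simp_all [add_comm]
    rw [hsum]
    have := mul_nonneg (abs_nonneg (v i - w i)) (abs_nonneg (v k - w k))
    nlinarith
  have h2 := le_max_left (|v i - w i| / (2 * d)) (|v k - w k| / (2 * d))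
  have h3 := le_max_right (|v i - w i| / (2 * d)) (|v k - w k| / (2 * d))
  rw [div_le_iff₀ (by positivity)] at h2 h3
  linarith

lemma dimH_slopeFrom_coordChart_le {i k : Fin 2} (hik : i ≠ k) {x₀ x : E2} {d : ℝ} (hd : 0 < d)
    {Y : Set E2} (hY : ∀ z ∈ Y, 0 < |z i - x i| ∧ |z k - x k| ≤ 2 * |z i - x i|) :
    dimH (slopeFrom (coordChart i k x₀ d x) '' (coordChart i k x₀ d '' Y)) ≤
      dimH (radProj x '' (Y \ {x})) := by
  have hsub : slopeFrom (coordChart i k x₀ d x) '' (coordChart i k x₀ d '' Y) ⊆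
      (fun e : E2 => e k / e i) '' (radProj x '' Y) := by
    rintro _ ⟨_, ⟨z, hz, rfl⟩, rfl⟩
    refine ⟨_, ⟨z, hz, rfl⟩, ?_⟩
    have h0 := abs_pos.1 (hY z hz).1
    have hzx : z - x ≠ 0 := fun h => h0 (by
      have := congrArg (fun v : E2 => v i) h
      simpa using this)
    have hn : ‖z - x‖ ≠ 0 := norm_ne_zero_iff.2 hzx
    have e : ∀ p, (z p - x₀ p) / (2 * d) - (x p - x₀ p) / (2 * d) = (z p - x p) / (2 * d) :=
      fun p => by ring
    simp only [slopeFrom, coordChart, radProj, e, PiLp.smul_apply, PiLp.sub_apply, smul_eq_mul]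
    rw [mul_div_mul_left _ _ (inv_ne_zero hn), div_div_div_cancel_right₀ (by positivity)]
  have hlip : LipschitzOnWith 18 (fun e : E2 => e k / e i) (radProj x '' Y) := by
    refine (lipschitzOnWith_div_coord i k).mono ?_
    rintro _ ⟨z, hz, rfl⟩
    obtain ⟨h1, h2⟩ := hY z hz
    have hle : ‖z - x‖ ≤ 3 * |z i - x i| := by
      rw [EuclideanSpace.norm_eq]
      refine Real.sqrt_le_iff.2 ⟨by positivity, ?_⟩
      have hsum : ∑ p, ‖(z - x) p‖ ^ 2 = |z i - x i| ^ 2 + |z k - x k| ^ 2 := by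
        simp only [Fin.sum_univ_two, Real.norm_eq_abs, PiLp.sub_apply]
        fin_cases i <;> fin_cases k <;> simp_all [add_comm]
      rw [hsum]
      have := abs_nonneg (z k - x k)
      nlinarith
    have hge : |z i - x i| ≤ ‖z - x‖ := PiLp.norm_apply_le (z - x) i
    have hn : 0 < ‖z - x‖ := h1.trans_le hge
    refine ⟨?_, ?_⟩
    · rw [radProj, norm_smul, norm_inv, norm_norm, inv_mul_cancel₀ hn.ne']
    · rw [radProj, PiLp.smul_apply, PiLp.sub_apply, smul_eq_mul, abs_mul, abs_inv, abs_norm,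
        inv_mul_eq_div, le_div_iff₀ hn]
      linarith
  refine (dimH_mono hsub).trans (hlip.dimH_image_le.trans (dimH_mono (image_mono fun z hz => ?_)))
  refine ⟨hz, fun h => ?_⟩
  have := (hY z hz).1
  rw [mem_singleton_iff.1 h] at this
  simp at this

lemma exists_coord_dominant (v : E2) (hv : v ≠ 0) :
    ∃ i k : Fin 2, i ≠ k ∧ |v k| ≤ |v i| ∧ 0 < |v i| := by
  have hmain : ∃ i k : Fin 2, i ≠ k ∧ |v k| ≤ |v i| := by
    rcases le_total |v 0| |v 1| with h | h
    · exact ⟨1, 0, by decide, h⟩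
    · exact ⟨0, 1, by decide, h⟩
  obtain ⟨i, k, hik, h⟩ := hmain
  refine ⟨i, k, hik, h, ?_⟩
  by_contra! h0
  have hi : v i = 0 := abs_nonpos_iff.1 h0
  have hk : v k = 0 := abs_nonpos_iff.1 (h.trans h0)
  refine hv (PiLp.ext fun p => ?_)
  fin_cases i <;> fin_cases k <;> fin_cases p <;> simp_all

theorem exists_le_dimH_radProj {X Y : Set E2} (hY : MeasurableSet Y) {s t : ℝ} {u : ℝ≥0}
    (hs : 0 ≤ s) (hsu : s < u) (hu1 : (u : ℝ) < 1) (ht0 : 0 < t) (ht : t < 2)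
    (hust : u < s + t - 1) (hXs : μH[s] X ≠ 0) (hYt : μH[t] Y ≠ 0) :
    ∃ x ∈ X, u ≤ dimH (radProj x '' (Y \ {x})) := by
  obtain ⟨x₀, hx₀, hX₀⟩ := exists_mem_forall_mem_nhdsWithin_pos_measure hXs
  have hYt' : μH[t] (Y \ {x₀}) ≠ 0 := by
    have := Measure.nullSingletonClass_hausdorff E2 ht0
    rwa [measure_sdiff_null (measure_singleton x₀)]
  obtain ⟨y₀, hy₀, hY₀⟩ := exists_mem_forall_mem_nhdsWithin_pos_measure hYt'
  obtain ⟨i, k, hik, hki, hi⟩ := exists_coord_dominant (y₀ - x₀) (sub_ne_zero.2 hy₀.2)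
  set d : ℝ := |(y₀ - x₀) i| with hd
  rw [PiLp.sub_apply] at hki hd
  set X' : Set E2 := X ∩ ball x₀ (d / 10) with hX'
  set Y' : Set E2 := Y ∩ ball y₀ (d / 10) with hY'
  have hXpos : μH[s] X' ≠ 0 := (hX₀ _ (inter_mem_nhdsWithin _ (ball_mem_nhds _ (by positivity)))).ne'
  have hYpos : μH[t] Y' ≠ 0 := by
    refine ((hY₀ _ (inter_mem_nhdsWithin _ (ball_mem_nhds y₀ (by positivity : 0 < d / 10)))).trans_le
      (measure_mono ?_)).ne'
    exact inter_subset_inter_left _ sdiff_subset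
  have hanti := antilipschitzWith_coordChart hik x₀ hi
  set Φ := coordChart i k x₀ d with hΦ
  have hpush : ∀ {r : ℝ} {S : Set E2}, 0 ≤ r → μH[r] S ≠ 0 → μH[r] (Φ '' S) ≠ 0 := by
    intro r S hr hS h0
    have := hanti.le_hausdorffMeasure_image hr S
    rw [h0, mul_zero] at this
    exact hS (le_antisymm this bot_le)
  have hcoord : ∀ (v w : E2) (p : Fin 2), |v p - w p| ≤ dist v w := fun v w p => by
    rw [dist_eq_norm]
    exact PiLp.norm_apply_le (v - w) p
  have hsmall : ∀ x ∈ X', ∀ p, |x p - x₀ p| ≤ d / 10 := fun x hx p =>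
    (hcoord _ _ p).trans (mem_ball.1 hx.2).le
  have hsmallY : ∀ z ∈ Y', ∀ p, |z p - y₀ p| ≤ d / 10 := fun z hz p =>
    (hcoord _ _ p).trans (mem_ball.1 hz.2).le
  have hdiff : ∀ x ∈ X', ∀ z ∈ Y', 4 / 5 * d ≤ |z i - x i| ∧ |z i - x i| ≤ 6 / 5 * d ∧
      |z k - x k| ≤ 6 / 5 * d := by
    intro x hx z hz
    have key : ∀ p, |(z p - x p) - (y₀ p - x₀ p)| ≤ d / 5 := fun p => by
      have e : (z p - x p) - (y₀ p - x₀ p) = (z p - y₀ p) - (x p - x₀ p) := by ring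
      rw [e]
      exact (abs_sub _ _).trans (by linarith [hsmall x hx p, hsmallY z hz p])
    have h1 := (abs_sub_abs_le_abs_sub (z i - x i) (y₀ i - x₀ i)).trans (key i)
    have h2 := (abs_sub_abs_le_abs_sub (y₀ i - x₀ i) (z i - x i)).trans
      ((abs_sub_comm _ _).le.trans (key i))
    have h3 := (abs_sub_abs_le_abs_sub (z k - x k) (y₀ k - x₀ k)).trans (key k)
    exact ⟨by linarith, by linarith, by linarith⟩
  have hseen : ∀ x ∈ Φ '' X', SeenFrom x (Φ '' Y') := by
    rintro _ ⟨x, hx, rfl⟩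
    have h2d : 0 < 2 * d := by positivity
    refine ⟨?_, ?_⟩
    · rw [Prod.norm_def]
      simp only [hΦ, coordChart, Real.norm_eq_abs, abs_div, abs_of_pos h2d]
      refine max_le ?_ ?_ <;> rw [div_le_one h2d]
      · linarith [hsmall x hx i]
      · linarith [hsmall x hx k]
    · rintro _ ⟨z, hz, rfl⟩
      obtain ⟨h1, h2, h3⟩ := hdiff x hx z hz
      have e : ∀ p, (z p - x₀ p) / (2 * d) - (x p - x₀ p) / (2 * d) = (z p - x p) / (2 * d) :=
        fun p => by ring
      refine ⟨?_, ?_⟩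
      · have hz' : ∀ p, |z p - x₀ p| ≤ |z p - x p| + d / 10 := fun p =>
          (abs_sub_le _ (x p) _).trans (by linarith [hsmall x hx p])
        rw [Prod.norm_def]
        simp only [hΦ, coordChart, Real.norm_eq_abs, abs_div, abs_of_pos h2d]
        refine max_le ?_ ?_ <;> rw [div_le_one h2d]
        · linarith [hz' i]
        · linarith [hz' k]
      · simp only [hΦ, coordChart, e, abs_div, abs_of_pos h2d]
        refine ⟨?_, ?_, ?_⟩
        · rw [le_div_iff₀ h2d]
          linarith
        · rw [div_le_one h2d]
          linarith
        · rw [← mul_div_assoc]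
          gcongr
          linarith
  have hYm : MeasurableSet (Φ '' Y') :=
    (hY.inter measurableSet_ball).image_of_continuousOn_injOn
      (continuous_coordChart i k x₀ d).continuousOn hanti.injective.injOn
  obtain ⟨_, ⟨x, hx, rfl⟩, hxu⟩ := exists_hausdorffMeasure_slopeFrom_ne_zero hYm hseen hs hsu hu1
    ht0 ht hust (hpush hs hXpos) (hpush ht0.le hYpos)
  refine ⟨x, hx.1, (le_dimH_of_hausdorffMeasure_ne_zero hxu).trans
    ((dimH_slopeFrom_coordChart_le hik hi fun z hz => ?_).trans
      (dimH_mono (image_mono (sdiff_subset_sdiff_left inter_subset_left))))⟩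
  obtain ⟨h1, h2, h3⟩ := hdiff x hx z hz
  exact ⟨by linarith, by linarith⟩

lemma exists_exponents {dX dY u : ℝ} (hY : 1 < dY) (hu : 0 < u)
    (h : u < dX + dY - 1) :
    ∃ s t, 0 ≤ s ∧ s < u ∧ (s = 0 ∨ s < dX) ∧ 1 < t ∧ t < dY ∧ u < s + t - 1 := by
  set ε := min ((dX + dY - 1 - u) / 4) ((dY - 1) / 4) with hε
  have hε0 : 0 < ε := lt_min (by linarith) (by linarith)
  have hε1 : ε ≤ (dX + dY - 1 - u) / 4 := min_le_left _ _
  have hε2 : ε ≤ (dY - 1) / 4 := min_le_right _ _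
  refine ⟨max 0 (min dX u - ε), dY - ε, le_max_left _ _, max_lt hu ?_, ?_, by linarith,
    by linarith, ?_⟩
  · linarith [min_le_right dX u]
  · rcases le_total (min dX u - ε) 0 with h0 | h0
    · exact Or.inl (max_eq_left h0)
    · refine Or.inr ?_
      rw [max_eq_right h0]
      linarith [min_le_left dX u]
  · have h1 := le_max_right 0 (min dX u - ε)
    rcases le_total dX u with h2 | h2
    · rw [min_eq_left h2] at h1 ⊢
      linarith
    · rw [min_eq_right h2] at h1 ⊢
      linarith

lemma dimH_le_two (S : Set E2) : dimH S ≤ 2 := by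
  refine (dimH_mono (subset_univ S)).trans ?_
  rw [Real.dimH_univ_eq_finrank]
  simp

/-- If `X, Y ⊆ ℝ²` are Borel, `X ≠ ∅`, and `dim_H Y > 1`, then
`sup_{x ∈ X} dim_H π_x(Y \ {x}) ≥ min{dim_H X + dim_H Y − 1, 1}`. -/
theorem radial_projection_large_Y (X Y : Set E2)
    (hXm : MeasurableSet X) (hYm : MeasurableSet Y)
    (hXne : X.Nonempty) (hY : 1 < dimH Y) :
    min (dimH X + dimH Y - 1) 1 ≤ ⨆ x ∈ X, dimH (radProj x '' (Y \ {x})) := by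
  refine ENNReal.le_of_forall_nnreal_lt fun u hu => ?_
  rcases eq_or_ne u 0 with rfl | hu0
  · simp
  have hu0 : (0 : ℝ) < u := NNReal.coe_pos.2 (pos_iff_ne_zero.2 hu0)
  obtain ⟨hu2, hu1⟩ := lt_min_iff.1 hu
  have hu1 : (u : ℝ) < 1 := by exact_mod_cast hu1
  have hXtop : dimH X ≠ ∞ := ne_top_of_le_ne_top (by simp) (dimH_le_two X)
  have hYtop : dimH Y ≠ ∞ := ne_top_of_le_ne_top (by simp) (dimH_le_two Y)
  have hY2 := dimH_le_two Y
  generalize hdX : dimH X = dX at *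
  generalize hdY : dimH Y = dY at *
  lift dX to ℝ≥0 using hXtop
  lift dY to ℝ≥0 using hYtop
  rw [lt_tsub_iff_right] at hu2
  have hu2 : (u : ℝ) + 1 < dX + dY := by exact_mod_cast hu2
  have hY1 : (1 : ℝ) < dY := by exact_mod_cast hY
  have hY2 : (dY : ℝ) ≤ 2 := by exact_mod_cast hY2
  obtain ⟨s, t, hs, hsu, hsX, ht1, htY, hust⟩ := exists_exponents (dX := dX) hY1 hu0
    (by linarith)
  have ht0 : 0 < t := by linarith
  have hXs : μH[s] X ≠ 0 := by
    rcases hsX with rfl | hsX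
    · exact (zero_lt_one.trans_le (Measure.one_le_hausdorffMeasure_zero_of_nonempty hXne)).ne'
    · lift s to ℝ≥0 using hs
      rw [hausdorffMeasure_of_lt_dimH (by rw [hdX]; exact_mod_cast hsX)]
      exact ENNReal.top_ne_zero
  have hYt : μH[t] Y ≠ 0 := by
    lift t to ℝ≥0 using ht0.le
    rw [hausdorffMeasure_of_lt_dimH (by rw [hdY]; exact_mod_cast htY)]
    exact ENNReal.top_ne_zero
  obtain ⟨x, hx, hux⟩ := exists_le_dimH_radProj hYm hs hsu hu1 ht0 (by linarith) hust hXs hYt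
  exact hux.trans (le_iSup₂_of_le x hx le_rfl)
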